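/- arXiv:1307.7901 — 4 statements merged into one kernel-verified Lean document; each statement's English description precedes it below -/
import Mathlib

section
/- Reverse dual Doob inequality: Let 0 < p ≤ 1 and let (Ω, ℱ, ℙ) be a probability space with a filtration (ℱ_i)_{i≥1}, and write E_i(·) = E[· | ℱ_i] for the associated conditional expectations. If (f_i)_{i≥1} is a sequence of nonnegative random variables in L¹(Ω), then (E(∑_{i≥1} f_i)^p)^{1/p} ≤ p^{-1} · (E(∑_{i≥1} E_i(f_i))^p)^{1/p}, where both sums are interpreted as (possibly infinite) pointwise sums in [0, ∞]. -/
open MeasureTheory ProbabilityTheory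
open scoped ENNReal NNReal

/-- Pulling an `m`-measurable `[0, ∞]`-valued factor out of a conditional expectation. -/
theorem lintegral_ofReal_condExp_mul {Ω : Type*} {m mΩ : MeasurableSpace Ω} {μ : Measure Ω}
    [IsFiniteMeasure μ] (hm : m ≤ mΩ) {f : Ω → ℝ} (hf : 0 ≤ᵐ[μ] f) (hint : Integrable f μ)
    {g : Ω → ℝ≥0∞} (hg : Measurable[m] g) :
    ∫⁻ ω, ENNReal.ofReal ((μ[f | m]) ω) * g ω ∂μ = ∫⁻ ω, ENNReal.ofReal (f ω) * g ω ∂μ := by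
  have hf' : AEMeasurable (fun ω ↦ ENNReal.ofReal (f ω)) μ :=
    hint.aestronglyMeasurable.aemeasurable.ennreal_ofReal
  have hc' : AEMeasurable (fun ω ↦ ENNReal.ofReal ((μ[f | m]) ω)) μ :=
    integrable_condExp.aestronglyMeasurable.aemeasurable.ennreal_ofReal
  have hg' : AEMeasurable g μ := (hg.mono hm le_rfl).aemeasurable
  have htrim : (μ.withDensity fun ω ↦ ENNReal.ofReal ((μ[f | m]) ω)).trim hm =
      (μ.withDensity fun ω ↦ ENNReal.ofReal (f ω)).trim hm := by
    refine @Measure.ext _ m _ _ fun s hs ↦ ?_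
    rw [trim_measurableSet_eq hm hs, trim_measurableSet_eq hm hs,
      withDensity_apply _ (hm s hs), withDensity_apply _ (hm s hs),
      ← ofReal_integral_eq_lintegral_ofReal integrable_condExp.integrableOn
        (ae_restrict_of_ae (condExp_nonneg hf)),
      ← ofReal_integral_eq_lintegral_ofReal hint.integrableOn (ae_restrict_of_ae hf),
      setIntegral_condExp hm hint hs]
  calc ∫⁻ ω, ENNReal.ofReal ((μ[f | m]) ω) * g ω ∂μ
      = ∫⁻ ω, g ω ∂(μ.withDensity fun ω ↦ ENNReal.ofReal ((μ[f | m]) ω)) :=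
        (lintegral_withDensity_eq_lintegral_mul₀ hc' hg').symm
    _ = ∫⁻ ω, g ω ∂(μ.withDensity fun ω ↦ ENNReal.ofReal (f ω)) := by
        rw [← lintegral_trim hm hg, htrim, lintegral_trim hm hg]
    _ = ∫⁻ ω, ENNReal.ofReal (f ω) * g ω ∂μ :=
        lintegral_withDensity_eq_lintegral_mul₀ hf' hg'

/-- The tangent line inequality for the concave function `x ↦ x ^ p`. -/
theorem ENNReal.rpow_add_mul_rpow_sub_one_le {p : ℝ} (hp0 : 0 < p) (hp1 : p ≤ 1)
    {a b : ℝ≥0∞} (ha : a ≠ ∞) (hb : b ≠ ∞) :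
    b ^ p + ENNReal.ofReal p * (a * (b + a) ^ (p - 1)) ≤ (b + a) ^ p := by
  rcases eq_or_ne a 0 with rfl | ha0
  · simp
  lift a to ℝ≥0 using ha
  lift b to ℝ≥0 using hb
  have ha' : (0 : ℝ) < a := by
    rw [NNReal.coe_pos, pos_iff_ne_zero]; exact_mod_cast ha0
  have hc : (0 : ℝ) < b + a := by positivity
  have hc0 : b + a ≠ 0 := by
    intro h; rw [← NNReal.coe_add, h] at hc; simp at hc
  rw [← ENNReal.coe_add, ← ENNReal.coe_rpow_of_ne_zero hc0, ← ENNReal.coe_rpow_of_ne_zero hc0,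
    ← ENNReal.coe_rpow_of_nonneg _ hp0.le, ENNReal.ofReal]
  norm_cast
  rw [← NNReal.coe_le_coe]
  push_cast
  rw [Real.coe_toNNReal _ hp0.le]
  have hbern := rpow_one_add_le_one_add_mul_self (s := (b : ℝ) / (b + a) - 1) (p := p)
    (by linarith [div_nonneg b.coe_nonneg hc.le]) hp0.le hp1
  rw [add_sub_cancel, Real.div_rpow b.coe_nonneg hc.le,
    div_le_iff₀ (Real.rpow_pos_of_pos hc p)] at hbern
  rw [Real.rpow_sub_one hc.ne']
  have : (1 + p * ((b : ℝ) / (b + a) - 1)) * (b + a) ^ p =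
      ((b : ℝ) + a) ^ p - p * (a * (((b : ℝ) + a) ^ p / (b + a))) := by
    field_simp
    ring
  linarith

theorem ENNReal.mul_sum_mul_rpow_sum_le {p : ℝ} (hp0 : 0 < p) (hp1 : p ≤ 1)
    {a : ℕ → ℝ≥0∞} (ha : ∀ i, a i ≠ ∞) (n : ℕ) :
    ENNReal.ofReal p * ∑ i ∈ Finset.range n, a i * (∑ j ∈ Finset.range (i + 1), a j) ^ (p - 1) ≤
      (∑ i ∈ Finset.range n, a i) ^ p := by
  induction n with
  | zero => simp
  | succ n ih =>
    rw [Finset.sum_range_succ, mul_add, Finset.sum_range_succ a n]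
    exact (add_le_add_left ih _).trans (ENNReal.rpow_add_mul_rpow_sub_one_le hp0 hp1 (ha n)
      (ENNReal.sum_ne_top.2 fun i _ ↦ ha i))

theorem ENNReal.mul_tsum_mul_rpow_sum_le {p : ℝ} (hp0 : 0 < p) (hp1 : p ≤ 1)
    {a : ℕ → ℝ≥0∞} (ha : ∀ i, a i ≠ ∞) :
    ENNReal.ofReal p * ∑' i, a i * (∑ j ∈ Finset.range (i + 1), a j) ^ (p - 1) ≤
      (∑' i, a i) ^ p := by
  rw [ENNReal.tsum_eq_iSup_nat, ENNReal.mul_iSup]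
  exact iSup_le fun n ↦ (ENNReal.mul_sum_mul_rpow_sum_le hp0 hp1 ha n).trans
    (ENNReal.rpow_le_rpow (ENNReal.sum_le_tsum _) hp0.le)

/-- The weighted `L¹` form of the reverse dual Doob inequality. -/
theorem mul_lintegral_tsum_mul_rpow_le
    {Ω : Type*} {mΩ : MeasurableSpace Ω} {μ : Measure Ω} [IsFiniteMeasure μ]
    (ℱ : Filtration ℕ mΩ) {p : ℝ} (hp0 : 0 < p) (hp1 : p ≤ 1) {f : ℕ → Ω → ℝ}
    (hnonneg : ∀ i, 0 ≤ᵐ[μ] f i) (hint : ∀ i, Integrable (f i) μ) :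
    ENNReal.ofReal p * ∫⁻ ω, (∑' i, ENNReal.ofReal (f i ω)) *
        (∑' i, ENNReal.ofReal ((μ[f i | ℱ i]) ω)) ^ (p - 1) ∂μ ≤
      ∫⁻ ω, (∑' i, ENNReal.ofReal ((μ[f i | ℱ i]) ω)) ^ p ∂μ := by
  set a : ℕ → Ω → ℝ≥0∞ := fun i ω ↦ ENNReal.ofReal ((μ[f i | ℱ i]) ω)
  have ham : ∀ i, Measurable[ℱ i] (a i) := fun i ↦
    stronglyMeasurable_condExp.measurable.ennreal_ofReal
  have hA : ∀ i, Measurable[ℱ i]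
      (fun ω ↦ (∑ j ∈ Finset.range (i + 1), a j ω) ^ (p - 1)) := fun i ↦
    (Finset.measurable_fun_sum _ fun j hj ↦
      (ham j).mono (ℱ.mono (Nat.lt_succ_iff.1 (Finset.mem_range.1 hj))) le_rfl).pow_const _
  have hA' : ∀ i, Measurable (fun ω ↦ (∑ j ∈ Finset.range (i + 1), a j ω) ^ (p - 1)) :=
    fun i ↦ (hA i).mono (ℱ.le i) le_rfl
  have hf : ∀ i, AEMeasurable (fun ω ↦ ENNReal.ofReal (f i ω)) μ := fun i ↦
    (hint i).aestronglyMeasurable.aemeasurable.ennreal_ofReal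
  calc _ ≤ ENNReal.ofReal p * ∫⁻ ω, ∑' i, ENNReal.ofReal (f i ω) *
          (∑ j ∈ Finset.range (i + 1), a j ω) ^ (p - 1) ∂μ := by
        gcongr with ω
        rw [← ENNReal.tsum_mul_right]
        refine ENNReal.tsum_le_tsum fun i ↦ mul_le_mul' le_rfl ?_
        rw [← neg_sub 1 p, ENNReal.rpow_neg, ENNReal.rpow_neg, ENNReal.inv_le_inv]
        exact ENNReal.rpow_le_rpow (ENNReal.sum_le_tsum _) (sub_nonneg.2 hp1)
    _ = ENNReal.ofReal p * ∫⁻ ω, ∑' i, a i ω *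
          (∑ j ∈ Finset.range (i + 1), a j ω) ^ (p - 1) ∂μ := by
        rw [lintegral_tsum fun i ↦ (hf i).fun_mul (hA' i).aemeasurable,
          lintegral_tsum fun i ↦
            ((ham i).mono (ℱ.le i) le_rfl).aemeasurable.fun_mul (hA' i).aemeasurable]
        congr 1
        exact tsum_congr fun i ↦
          (lintegral_ofReal_condExp_mul (ℱ.le i) (hnonneg i) (hint i) (hA i)).symm
    _ = ∫⁻ ω, ENNReal.ofReal p * ∑' i, a i ω *
          (∑ j ∈ Finset.range (i + 1), a j ω) ^ (p - 1) ∂μ :=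
        (lintegral_const_mul' _ _ ENNReal.ofReal_ne_top).symm
    _ ≤ _ := lintegral_mono fun ω ↦
        ENNReal.mul_tsum_mul_rpow_sum_le hp0 hp1 fun i ↦ ENNReal.ofReal_ne_top

theorem ENNReal.rpow_le_mul_rpow_sub_one_rpow_mul {p : ℝ} (hp0 : 0 < p) (hp1 : p ≤ 1)
    {s a : ℝ≥0∞} (ha : a ≠ ∞) (hs : s * a ^ (p - 1) ≠ ∞) :
    s ^ p ≤ (s * a ^ (p - 1)) ^ p * (a ^ p) ^ (1 - p) := by
  rcases hp1.eq_or_lt with rfl | hp1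
  · simp
  rcases eq_or_ne a 0 with rfl | ha0
  · have : s = 0 := by
      by_contra h
      exact hs (by rw [ENNReal.zero_rpow_of_neg (by linarith), ENNReal.mul_top h])
    simp [this, hp0]
  · rw [ENNReal.mul_rpow_of_nonneg _ _ hp0.le, mul_assoc, ← ENNReal.rpow_mul,
      ← ENNReal.rpow_mul, ← ENNReal.rpow_add _ _ ha0 ha]
    ring_nf
    simp

/-- **Reverse dual Doob inequality.**
Let `0 < p ≤ 1`, let `(Ω, ℱ, ℙ)` be a probability space with a filtration `(ℱ i)`,
and let `(f i)` be a sequence of nonnegative random variables in `L¹(Ω)`. Then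
`(E (∑' i, f i)^p)^(1/p) ≤ p⁻¹ (E (∑' i, E[f i | ℱ i])^p)^(1/p)`,
where the (possibly infinite) sums are taken pointwise in `[0, ∞]`. -/
theorem reverse_dual_doob
    {Ω : Type*} {mΩ : MeasurableSpace Ω} {μ : Measure Ω} [IsProbabilityMeasure μ]
    (ℱ : Filtration ℕ mΩ) (p : ℝ) (hp0 : 0 < p) (hp1 : p ≤ 1)
    (f : ℕ → Ω → ℝ)
    (hnonneg : ∀ i ω, 0 ≤ f i ω) (hint : ∀ i, Integrable (f i) μ) :
    (∫⁻ ω, (∑' i, ENNReal.ofReal (f i ω)) ^ p ∂μ) ^ (1 / p) ≤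
      ENNReal.ofReal p⁻¹ *
        (∫⁻ ω, (∑' i, ENNReal.ofReal ((μ[f i | ℱ i]) ω)) ^ p ∂μ) ^ (1 / p) := by
  have hweight := mul_lintegral_tsum_mul_rpow_le ℱ hp0 hp1
    (fun i ↦ ae_of_all μ (hnonneg i)) hint
  set S : Ω → ℝ≥0∞ := fun ω ↦ ∑' i, ENNReal.ofReal (f i ω)
  set A : Ω → ℝ≥0∞ := fun ω ↦ ∑' i, ENNReal.ofReal ((μ[f i | ℱ i]) ω)
  change ENNReal.ofReal p * ∫⁻ ω, S ω * A ω ^ (p - 1) ∂μ ≤ ∫⁻ ω, A ω ^ p ∂μ at hweight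
  change (∫⁻ ω, S ω ^ p ∂μ) ^ (1 / p) ≤
    ENNReal.ofReal p⁻¹ * (∫⁻ ω, A ω ^ p ∂μ) ^ (1 / p)
  have hS : AEMeasurable S μ := AEMeasurable.tsum fun i ↦
    (hint i).aestronglyMeasurable.aemeasurable.ennreal_ofReal
  have hA : AEMeasurable A μ := AEMeasurable.tsum fun i ↦
    integrable_condExp.aestronglyMeasurable.aemeasurable.ennreal_ofReal
  have hpinv : ENNReal.ofReal p⁻¹ = (ENNReal.ofReal p)⁻¹ := ENNReal.ofReal_inv_of_pos hp0
  have hp0' : ENNReal.ofReal p ≠ 0 := by simpa using hp0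
  rw [mul_comm, ← ENNReal.le_div_iff_mul_le (.inl hp0') (.inl ENNReal.ofReal_ne_top),
    div_eq_mul_inv, mul_comm, ← hpinv] at hweight
  rcases eq_or_ne (∫⁻ ω, A ω ^ p ∂μ) ∞ with htop | htop
  · rw [htop, ENNReal.top_rpow_of_pos (by positivity), ENNReal.mul_top (by simpa using hp0)]
    exact le_top
  have hAfin : ∀ᵐ ω ∂μ, A ω ≠ ∞ := by
    filter_upwards [ae_lt_top' (hA.pow_const p) htop] with ω hω h
    simp [h, hp0] at hω
  have hWfin : ∀ᵐ ω ∂μ, S ω * A ω ^ (p - 1) < ∞ :=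
    ae_lt_top' (hS.mul (hA.pow_const _))
      (hweight.trans_lt (ENNReal.mul_lt_top ENNReal.ofReal_lt_top htop.lt_top)).ne
  have hmain : ∫⁻ ω, S ω ^ p ∂μ ≤ ENNReal.ofReal p⁻¹ ^ p * ∫⁻ ω, A ω ^ p ∂μ :=
    calc ∫⁻ ω, S ω ^ p ∂μ
        ≤ ∫⁻ ω, (S ω * A ω ^ (p - 1)) ^ p * (A ω ^ p) ^ (1 - p) ∂μ := by
          refine lintegral_mono_ae ?_
          filter_upwards [hAfin, hWfin] with ω h1 h2
          exact ENNReal.rpow_le_mul_rpow_sub_one_rpow_mul hp0 hp1 h1 h2.ne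
      _ ≤ (∫⁻ ω, S ω * A ω ^ (p - 1) ∂μ) ^ p * (∫⁻ ω, A ω ^ p ∂μ) ^ (1 - p) :=
          ENNReal.lintegral_mul_norm_pow_le (hS.mul (hA.pow_const _)) (hA.pow_const _)
            hp0.le (sub_nonneg.2 hp1) (by ring)
      _ ≤ (ENNReal.ofReal p⁻¹ * ∫⁻ ω, A ω ^ p ∂μ) ^ p * (∫⁻ ω, A ω ^ p ∂μ) ^ (1 - p) := by
          gcongr
      _ = ENNReal.ofReal p⁻¹ ^ p * ∫⁻ ω, A ω ^ p ∂μ := by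
          rw [ENNReal.mul_rpow_of_nonneg _ _ hp0.le, mul_assoc,
            ← ENNReal.rpow_add_of_nonneg _ _ hp0.le (sub_nonneg.2 hp1), add_sub_cancel,
            ENNReal.rpow_one]
  calc (∫⁻ ω, S ω ^ p ∂μ) ^ (1 / p)
      ≤ (ENNReal.ofReal p⁻¹ ^ p * ∫⁻ ω, A ω ^ p ∂μ) ^ (1 / p) := by gcongr
    _ = ENNReal.ofReal p⁻¹ * (∫⁻ ω, A ω ^ p ∂μ) ^ (1 / p) := by
        rw [ENNReal.mul_rpow_of_nonneg _ _ (by positivity), ← ENNReal.rpow_mul,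
          mul_one_div_cancel hp0.ne', ENNReal.rpow_one]
end

section
/- For every 1 ≤ p < ∞ there exist constants b_p, c_p > 0, depending only on p, such that for every 0 ≤ λ ≤ 1 and every random variable N that is Poisson distributed with parameter λ, one has b_p · λ ≤ E|N − λ|^p ≤ c_p · λ. -/
open MeasureTheory ProbabilityTheory
open scoped ENNReal NNReal

open scoped Nat in
/-- Each term of the series for the centered `p`-th moment of a Poisson law with parameter
`l ≤ 1` is at most `l` times the corresponding term of the series for `exp (exp p)`. -/
lemma poisson_mul_abs_sub_rpow_le {p l : ℝ} (hp : 1 ≤ p) (h0 : 0 ≤ l) (h1 : l ≤ 1) (n : ℕ) :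
    Real.exp (-l) * l ^ n / n ! * |(n : ℝ) - l| ^ p ≤ l * (Real.exp p ^ n / n !) := by
  have hexp : Real.exp (-l) ≤ 1 := Real.exp_le_one_iff.2 (by linarith)
  rcases Nat.eq_zero_or_pos n with rfl | hn
  · have hlp : l ^ p ≤ l := by
      simpa using Real.rpow_le_rpow_of_exponent_ge_of_imp h0 h1 hp (by intros; linarith)
    simpa [abs_of_nonneg h0] using
      (mul_le_of_le_one_left (Real.rpow_nonneg h0 p) hexp).trans hlp
  · have hn' : (1 : ℝ) ≤ n := by exact_mod_cast hn
    have hlow : l ^ n ≤ l := pow_le_of_le_one h0 h1 hn.ne'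
    have habs : |(n : ℝ) - l| ^ p ≤ Real.exp p ^ n := by
      have hle : |(n : ℝ) - l| ≤ Real.exp n := by
        rw [abs_of_nonneg (by linarith)]
        linarith [Real.add_one_le_exp (n : ℝ)]
      calc |(n : ℝ) - l| ^ p ≤ Real.exp n ^ p := by gcongr
        _ = Real.exp p ^ n := by rw [← Real.exp_mul, ← Real.exp_nat_mul]
    calc Real.exp (-l) * l ^ n / n ! * |(n : ℝ) - l| ^ p
        ≤ 1 * l / n ! * Real.exp p ^ n := by gcongr
      _ = l * (Real.exp p ^ n / n !) := by ring

open scoped Nat in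
/-- For `l ≤ 1`, either the term at `1` or the term at `2` of the series for the centered
`p`-th moment of a Poisson law is at least a constant times the parameter `l`. -/
lemma exists_le_poisson_mul_abs_sub_rpow {p l : ℝ} (hp : 0 ≤ p) (h0 : 0 ≤ l) (h1 : l ≤ 1) :
    ∃ n : ℕ, Real.exp (-1) * (1 / 4) * (1 / 2) ^ p * l ≤
      Real.exp (-l) * l ^ n / n ! * |(n : ℝ) - l| ^ p := by
  have hexp : Real.exp (-1) ≤ Real.exp (-l) := Real.exp_le_exp.2 (by linarith)
  rcases le_total l (1 / 2) with h | h
  · refine ⟨1, ?_⟩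
    have habs : 1 / 2 ≤ |((1 : ℕ) : ℝ) - l| := by
      rw [Nat.cast_one, abs_of_nonneg (by linarith)]
      linarith
    calc Real.exp (-1) * (1 / 4) * (1 / 2) ^ p * l
        = Real.exp (-1) * (l / 4) * (1 / 2) ^ p := by ring
      _ ≤ Real.exp (-l) * l * |((1 : ℕ) : ℝ) - l| ^ p := by
        gcongr
        linarith
      _ = _ := by simp
  · refine ⟨2, ?_⟩
    have habs : 1 / 2 ≤ |((2 : ℕ) : ℝ) - l| := by
      rw [Nat.cast_two, abs_of_nonneg (by linarith)]
      linarith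
    have hsq : l / 4 ≤ l ^ 2 / 2 := by nlinarith
    calc Real.exp (-1) * (1 / 4) * (1 / 2) ^ p * l
        = Real.exp (-1) * (l / 4) * (1 / 2) ^ p := by ring
      _ ≤ Real.exp (-l) * (l ^ 2 / 2) * |((2 : ℕ) : ℝ) - l| ^ p := mul_le_mul (mul_le_mul hexp hsq (by positivity) (by positivity))
        (Real.rpow_le_rpow (by norm_num) habs hp) (by positivity) (by positivity)
      _ = _ := by simp [mul_div_assoc]

/-- For every `1 ≤ p < ∞` there exist constants `b_p, c_p > 0`, depending only on `p`,
such that for every `0 ≤ λ ≤ 1` and every Poisson random variable `N` with parameter `λ`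
one has `b_p λ ≤ E|N - λ|^p ≤ c_p λ`. -/
theorem poisson_centered_moments (p : ℝ) (hp : 1 ≤ p) :
    ∃ b c : ℝ, 0 < b ∧ 0 < c ∧
      ∀ (Ω : Type) (mΩ : MeasurableSpace Ω) (μ : Measure Ω), IsProbabilityMeasure μ →
      ∀ (l : ℝ≥0), l ≤ 1 →
      ∀ (N : Ω → ℕ), Measurable N → Measure.map N μ = poissonMeasure l →
        b * l ≤ ∫ ω, |(N ω : ℝ) - l| ^ p ∂μ ∧
          ∫ ω, |(N ω : ℝ) - l| ^ p ∂μ ≤ c * l := by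
  refine ⟨Real.exp (-1) * (1 / 4) * (1 / 2) ^ p, Real.exp (Real.exp p), by positivity,
    by positivity, fun Ω mΩ μ _ l hl N hN hmap ↦ ?_⟩
  have h0 : (0 : ℝ) ≤ l := l.2
  have h1 : (l : ℝ) ≤ 1 := by exact_mod_cast hl
  have hint : ∫ ω, |(N ω : ℝ) - l| ^ p ∂μ = ∫ n : ℕ, |(n : ℝ) - l| ^ p ∂(poissonMeasure l) := by
    rw [← hmap, integral_map hN.aemeasurable .of_discrete]
  have hbound : HasSum (fun n : ℕ ↦ (l : ℝ) * (Real.exp p ^ n / n.factorial))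
      (l * Real.exp (Real.exp p)) := by
    have hexp := NormedSpace.expSeries_div_hasSum_exp (Real.exp p)
    rw [← Real.exp_eq_exp_ℝ] at hexp
    exact hexp.mul_left _
  have hnonneg (n : ℕ) :
      0 ≤ Real.exp (-l) * (l : ℝ) ^ n / n.factorial * |(n : ℝ) - l| ^ p := by
    positivity
  have hle := poisson_mul_abs_sub_rpow_le hp h0 h1
  have hsummable := Summable.of_nonneg_of_le hnonneg hle hbound.summable
  rw [hint, integral_poissonMeasure]
  simp only [smul_eq_mul]
  constructor
  · obtain ⟨n, hn⟩ := exists_le_poisson_mul_abs_sub_rpow (zero_le_one.trans hp) h0 h1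
    exact hn.trans (hsummable.le_tsum n fun m _ ↦ hnonneg m)
  · rw [mul_comm, ← hbound.tsum_eq]
    exact hsummable.tsum_le_tsum hle hbound.summable
end

section
/- Stein-type inequality for conditioned simple processes: Let X be a Banach space, 1 < p < ∞ and 1 ≤ s < ∞. Let 0 = t_1 < t_2 < ... < t_{l+1} < ∞, let (ℱ_t)_{t≥0} be a filtration on a probability space (Ω, ℱ, ℙ), let F_{ijk} ∈ L^∞(Ω) and x_{ijk} ∈ X for i = 1,...,l, j = 1,...,m, k = 1,...,n, and let w_{ij} = (t_{i+1} − t_i)·ν_j with arbitrary ν_1,...,ν_m ∈ [0, ∞). Then there is a constant C depending only on p and s such that ‖ ( ∑_{i,j} w_{ij} ‖ ∑_k E[F_{ijk} | ℱ_{t_i}] x_{ijk} ‖_X^s )^{1/s} ‖_{L^p(Ω)} ≤ C · ‖ ( ∑_{i,j} w_{ij} ‖ ∑_k F_{ijk} x_{ijk} ‖_X^s )^{1/s} ‖_{L^p(Ω)}. -/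
open MeasureTheory ProbabilityTheory
open scoped ENNReal NNReal

section SteinInequality

variable {Ω ι : Type*} {mΩ : MeasurableSpace Ω} {μ : Measure Ω}

/-- The norm of the finite family `f` in `L^p(Ω; ℓ^s(S))`. -/
noncomputable def mixedNorm (μ : Measure Ω) (p s : ℝ) (S : Finset ι) (f : ι → Ω → ℝ) : ℝ :=
  (∫ ω, (∑ i ∈ S, |f i ω| ^ s) ^ (p / s) ∂μ) ^ (1 / p)

theorem Real.rpow_le_rpow_add_mul_sub {x y q : ℝ} (hx : 0 ≤ x) (hxy : x ≤ y) (hq : 1 ≤ q) :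
    y ^ q ≤ x ^ q + q * ((y - x) * y ^ (q - 1)) := by
  rcases (hx.trans hxy).eq_or_lt with rfl | hy
  · obtain rfl : x = 0 := le_antisymm hxy hx
    simp
  have h := one_add_mul_self_le_rpow_one_add (s := x / y - 1)
    (by linarith [div_nonneg hx hy.le]) hq
  rw [add_sub_cancel, Real.div_rpow hx hy.le, le_div_iff₀ (by positivity)] at h
  have h1 : y ^ q = y * y ^ (q - 1) := by
    rw [Real.rpow_sub_one hy.ne']; field_simp
  have h2 : (1 + q * (x / y - 1)) * y ^ q = y ^ q - q * ((y - x) * y ^ (q - 1)) := by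
    rw [h1]; field_simp; ring
  linarith

theorem Finset.sum_rpow_le_mul_sum_mul_rpow [LinearOrder ι] {q : ℝ} (hq : 1 ≤ q) (S : Finset ι)
    {e : ι → ℝ} (he : ∀ i, 0 ≤ e i) :
    (∑ i ∈ S, e i) ^ q ≤ q * ∑ i ∈ S, e i * (∑ j ∈ S with j ≤ i, e j) ^ (q - 1) := by
  induction S using Finset.induction_on_max with
  | empty => simp [Real.zero_rpow (by linarith : q ≠ 0)]
  | insert a S ha ih =>
    have haS : a ∉ S := fun h => lt_irrefl _ (ha a h)
    have h0 : 0 ≤ ∑ i ∈ S, e i := Finset.sum_nonneg fun i _ => he i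
    have hfa : (insert a S).filter (· ≤ a) = insert a S :=
      Finset.filter_true_of_mem fun x hx => by
        rcases Finset.mem_insert.1 hx with rfl | hx
        exacts [le_rfl, (ha x hx).le]
    have hfi : ∀ i ∈ S, (insert a S).filter (· ≤ i) = S.filter (· ≤ i) := fun i hi => by
      rw [Finset.filter_insert, if_neg (not_le.2 (ha i hi))]
    have hsum : ∑ i ∈ S, e i * (∑ j ∈ insert a S with j ≤ i, e j) ^ (q - 1) =
        ∑ i ∈ S, e i * (∑ j ∈ S with j ≤ i, e j) ^ (q - 1) :=
      Finset.sum_congr rfl fun i hi => by rw [hfi i hi]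
    rw [Finset.sum_insert haS, Finset.sum_insert haS, hfa, hsum, Finset.sum_insert haS]
    have h := Real.rpow_le_rpow_add_mul_sub h0 (le_add_of_nonneg_left (he a)) hq
    rw [add_sub_cancel_right] at h
    linarith

theorem Real.rpow_one_div_le_of_le_mul_rpow {I K p q : ℝ} (hpq : p.HolderConjugate q)
    (hI : 0 ≤ I) (hK : 0 ≤ K) (h : I ≤ K * I ^ (1 / q)) : I ^ (1 / p) ≤ K := by
  rcases hI.eq_or_lt with rfl | hI
  · rwa [Real.zero_rpow (one_div_pos.2 hpq.pos).ne']
  have h1 : I = I ^ (1 / p) * I ^ (1 / q) := by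
    rw [← Real.rpow_add hI, one_div, one_div, hpq.inv_add_inv_eq_one, Real.rpow_one]
  exact le_of_mul_le_mul_right (h1.symm.trans_le h) (Real.rpow_pos_of_pos hI _)

theorem MeasureTheory.MemLp.rpow_const_top {f : Ω → ℝ} (hf : MemLp f ∞ μ) {r : ℝ} (hr : 0 ≤ r) :
    MemLp (fun ω => f ω ^ r) ∞ μ := by
  refine memLp_top_of_bound
    ((Real.continuous_rpow_const hr).comp_aestronglyMeasurable hf.1)
    ((eLpNormEssSup f μ).toReal ^ r) ?_
  have hfin : eLpNormEssSup f μ ≠ ∞ := by simpa [eLpNorm_exponent_top] using hf.2.ne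
  filter_upwards [ae_le_eLpNormEssSup (f := f) (μ := μ)] with ω hω
  have h1 : |f ω| ≤ (eLpNormEssSup f μ).toReal := by
    have := ENNReal.toReal_mono hfin hω
    simpa using this
  exact (Real.abs_rpow_le_abs_rpow _ _).trans (Real.rpow_le_rpow (abs_nonneg _) h1 hr)

theorem memLp_top_sum_abs_rpow (S : Finset ι) {f : ι → Ω → ℝ} (hf : ∀ i, MemLp (f i) ∞ μ)
    {s : ℝ} (hs : 0 ≤ s) : MemLp (fun ω => ∑ i ∈ S, |f i ω| ^ s) ∞ μ :=
  memLp_finsetSum S fun i _ => (hf i).abs.rpow_const_top hs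

theorem sum_abs_rpow_nonneg (S : Finset ι) (f : ι → Ω → ℝ) (s : ℝ) (ω : Ω) :
    0 ≤ ∑ i ∈ S, |f i ω| ^ s :=
  Finset.sum_nonneg fun _ _ => Real.rpow_nonneg (abs_nonneg _) _

theorem mixedNorm_nonneg (p s : ℝ) (S : Finset ι) (f : ι → Ω → ℝ) : 0 ≤ mixedNorm μ p s S f :=
  Real.rpow_nonneg (integral_nonneg fun ω => Real.rpow_nonneg (sum_abs_rpow_nonneg S f s ω) _) _

theorem mixedNorm_mono [IsFiniteMeasure μ] {p s : ℝ} (hp : 0 < p) (hs : 0 < s) (S : Finset ι)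
    {f g : ι → Ω → ℝ} (hg : ∀ i, MemLp (g i) ∞ μ) (hfg : ∀ i, ∀ᵐ ω ∂μ, |f i ω| ≤ |g i ω|) :
    mixedNorm μ p s S f ≤ mixedNorm μ p s S g := by
  refine Real.rpow_le_rpow
    (integral_nonneg fun ω => Real.rpow_nonneg (sum_abs_rpow_nonneg S f s ω) _) ?_ (by positivity)
  refine integral_mono_of_nonneg (.of_forall fun ω => Real.rpow_nonneg (sum_abs_rpow_nonneg S f s ω) _)
    (((memLp_top_sum_abs_rpow S hg hs.le).rpow_const_top (by positivity)).integrable le_top) ?_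
  have h : ∀ᵐ ω ∂μ, ∀ i ∈ S, |f i ω| ≤ |g i ω| :=
    (Filter.eventually_all_finset S).2 fun i _ => hfg i
  filter_upwards [h] with ω hω
  refine Real.rpow_le_rpow (sum_abs_rpow_nonneg S f s ω) ?_ (by positivity)
  exact Finset.sum_le_sum fun i hi => Real.rpow_le_rpow (abs_nonneg _) (hω i hi) hs.le

theorem norm_sum_condExp_smul_le {X κ : Type*} [NormedAddCommGroup X] [NormedSpace ℝ X]
    (m : MeasurableSpace Ω) (K : Finset κ) {F : κ → Ω → ℝ} (hF : ∀ k, Integrable (F k) μ)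
    (x : κ → X) :
    ∀ᵐ ω ∂μ, ‖∑ k ∈ K, (μ[F k | m]) ω • x k‖ ≤ (μ[fun ω => ‖∑ k ∈ K, F k ω • x k‖ | m]) ω := by
  let y : κ → UniformSpace.Completion X := fun k => (x k : UniformSpace.Completion X)
  have hnorm : ∀ c : κ → ℝ, ‖∑ k ∈ K, c k • x k‖ = ‖∑ k ∈ K, c k • y k‖ := fun c => by
    rw [← UniformSpace.Completion.norm_coe (∑ k ∈ K, c k • x k)]
    congr 1
    exact (map_sum (UniformSpace.Completion.toComplL (𝕜 := ℝ) (E := X)) _ K).trans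
      (Finset.sum_congr rfl fun k _ => UniformSpace.Completion.coe_smul _ _)
  simp_rw [hnorm]
  have hterm : ∀ᵐ ω ∂μ, ∀ k ∈ K, (μ[F k | m]) ω • y k = (μ[fun ω => F k ω • y k | m]) ω :=
    (Filter.eventually_all_finset K).2 fun k _ =>
      ((ContinuousLinearMap.id ℝ ℝ).smulRight (y k)).comp_condExp_comm (hF k)
  have hsum := condExp_finsetSum (s := K) (f := fun k ω => F k ω • y k) (μ := μ)
    (fun k _ => (hF k).smul_const (y k)) m
  filter_upwards [hterm, hsum, norm_condExp_le (m := m) (μ := μ) (∑ k ∈ K, fun ω => F k ω • y k)]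
    with ω h1 h2 h3
  rw [Finset.sum_congr rfl h1, ← Finset.sum_apply, ← h2]
  simpa only [Finset.sum_apply] using h3

variable [IsProbabilityMeasure μ]

theorem integral_condExp_mul_comm {m : MeasurableSpace Ω} (hm : m ≤ mΩ) {f g : Ω → ℝ}
    (hf : MemLp f ∞ μ) (hg : MemLp g ∞ μ) :
    ∫ ω, (μ[f | m]) ω * g ω ∂μ = ∫ ω, f ω * (μ[g | m]) ω ∂μ := by
  have hf' := hf.condExp (m := m) le_top
  have hg' := hg.condExp (m := m) le_top
  have h1 := condExp_mul_of_stronglyMeasurable_left (m := m) (μ := μ) (f := μ[f | m]) (g := g)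
    stronglyMeasurable_condExp ((hg.mul hf').integrable le_top) (hg.integrable le_top)
  have h2 := condExp_mul_of_stronglyMeasurable_right (m := m) (μ := μ) (f := f) (g := μ[g | m])
    stronglyMeasurable_condExp ((hg'.mul hf).integrable le_top) (hf.integrable le_top)
  calc ∫ ω, (μ[f | m]) ω * g ω ∂μ = ∫ ω, (μ[(μ[f | m]) * g | m]) ω ∂μ := (integral_condExp hm).symm
    _ = ∫ ω, (μ[f * (μ[g | m]) | m]) ω ∂μ := integral_congr_ae (h1.trans h2.symm)
    _ = ∫ ω, f ω * (μ[g | m]) ω ∂μ := integral_condExp hm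

/-- The dual form of Doob's maximal inequality. -/
theorem integral_sum_condExp_rpow_le [LinearOrder ι] {q : ℝ} (hq : 1 ≤ q) (S : Finset ι)
    {m : ι → MeasurableSpace Ω} (hm : ∀ i, m i ≤ mΩ) (hmono : MonotoneOn m S)
    {b : ι → Ω → ℝ} (hb : ∀ i, MemLp (b i) ∞ μ) (hb0 : ∀ i ω, 0 ≤ b i ω) :
    (∫ ω, (∑ i ∈ S, |(μ[b i | m i]) ω|) ^ q ∂μ) ^ (1 / q) ≤
      q * (∫ ω, (∑ i ∈ S, b i ω) ^ q ∂μ) ^ (1 / q) := by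
  set e : ι → Ω → ℝ := fun i => μ[b i | m i] with he
  have hq0 : 0 ≤ q - 1 := by linarith
  have heb : ∀ i, MemLp (e i) ∞ μ := fun i => (hb i).condExp le_top
  have he0 : ∀ i, ∀ᵐ ω ∂μ, 0 ≤ e i ω := fun i => condExp_nonneg (.of_forall (hb0 i))
  set T : Ω → ℝ := fun ω => ∑ i ∈ S, |e i ω| with hT
  have hT0 : ∀ ω, 0 ≤ T ω := fun ω => Finset.sum_nonneg fun _ _ => abs_nonneg _
  have hTb : MemLp T ∞ μ := memLp_finsetSum S fun i _ => (heb i).abs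
  set h : ι → Ω → ℝ := fun i ω => (∑ j ∈ S with j ≤ i, |e j ω|) ^ (q - 1) with hh
  have hhb : ∀ i, MemLp (h i) ∞ μ := fun i =>
    MemLp.rpow_const_top (memLp_finsetSum _ fun j _ => (heb j).abs) hq0
  have hhm : ∀ i ∈ S, StronglyMeasurable[m i] (h i) := fun i hi => by
    refine (Real.continuous_rpow_const hq0).comp_stronglyMeasurable ?_
    refine Finset.stronglyMeasurable_fun_sum _ fun j hj => ?_
    obtain ⟨hjS, hji⟩ := Finset.mem_filter.1 hj
    exact continuous_abs.comp_stronglyMeasurable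
      (stronglyMeasurable_condExp.mono (hmono hjS hi hji))
  have hhT : ∀ i ω, h i ω ≤ T ω ^ (q - 1) := fun i ω =>
    Real.rpow_le_rpow (Finset.sum_nonneg fun _ _ => abs_nonneg _)
      (Finset.sum_le_sum_of_subset_of_nonneg (Finset.filter_subset _ _)
        fun _ _ _ => abs_nonneg _) hq0
  set B : Ω → ℝ := fun ω => ∑ i ∈ S, b i ω with hB
  have hB0 : ∀ ω, 0 ≤ B ω := fun ω => Finset.sum_nonneg fun i _ => hb0 i ω
  have hBb : MemLp B ∞ μ := memLp_finsetSum S fun i _ => hb i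
  have hTq := hTb.rpow_const_top hq0
  have hint : ∀ i, Integrable (fun ω => |e i ω| * h i ω) μ := fun i =>
    ((hhb i).mul (heb i).abs).integrable le_top
  have hint' : ∀ i, Integrable (fun ω => b i ω * h i ω) μ := fun i =>
    ((hhb i).mul (hb i)).integrable le_top
  have key : ∫ ω, T ω ^ q ∂μ ≤ q * ∫ ω, B ω * T ω ^ (q - 1) ∂μ := calc
    ∫ ω, T ω ^ q ∂μ ≤ ∫ ω, q * ∑ i ∈ S, |e i ω| * h i ω ∂μ :=
      integral_mono ((hTb.rpow_const_top (by linarith)).integrable le_top)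
        ((integrable_finsetSum _ fun i _ => hint i).const_mul q)
        fun ω => Finset.sum_rpow_le_mul_sum_mul_rpow hq S fun i => abs_nonneg (e i ω)
    _ = q * ∑ i ∈ S, ∫ ω, b i ω * h i ω ∂μ := by
      rw [integral_const_mul, integral_finsetSum _ fun i _ => hint i]
      congr 1
      refine Finset.sum_congr rfl fun i hi => ?_
      calc ∫ ω, |e i ω| * h i ω ∂μ = ∫ ω, e i ω * h i ω ∂μ := by
            refine integral_congr_ae ?_
            filter_upwards [he0 i] with ω hω
            rw [abs_of_nonneg hω]
        _ = ∫ ω, b i ω * (μ[h i | m i]) ω ∂μ := integral_condExp_mul_comm (hm i) (hb i) (hhb i)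
        _ = _ := by
          rw [condExp_of_stronglyMeasurable (hm i) (hhm i hi) ((hhb i).integrable le_top)]
    _ = q * ∫ ω, ∑ i ∈ S, b i ω * h i ω ∂μ := by
      rw [integral_finsetSum _ fun i _ => hint' i]
    _ ≤ q * ∫ ω, B ω * T ω ^ (q - 1) ∂μ := by
      refine mul_le_mul_of_nonneg_left (integral_mono (integrable_finsetSum _ fun i _ => hint' i)
        ((hTq.mul hBb).integrable le_top) fun ω => ?_) (by linarith)
      simp only [hB, Finset.sum_mul]
      exact Finset.sum_le_sum fun i _ => mul_le_mul_of_nonneg_left (hhT i ω) (hb0 i ω)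
  rcases hq.eq_or_lt with rfl | hq1
  · simpa using key
  have hqq := Real.HolderConjugate.conjExponent hq1
  refine Real.rpow_one_div_le_of_le_mul_rpow hqq
    (integral_nonneg fun ω => Real.rpow_nonneg (hT0 ω) _)
    (mul_nonneg (by linarith) (Real.rpow_nonneg
      (integral_nonneg fun ω => Real.rpow_nonneg (hB0 ω) _) _)) ?_
  rw [mul_assoc]
  refine key.trans (mul_le_mul_of_nonneg_left ?_ (by linarith))
  have hold := integral_mul_le_Lp_mul_Lq_of_nonneg (μ := μ) hqq (.of_forall hB0)
    (.of_forall fun ω => Real.rpow_nonneg (hT0 ω) (q - 1))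
    (hBb.mono_exponent le_top) (hTq.mono_exponent le_top)
  refine hold.trans_eq ?_
  congr 3
  ext ω
  rw [← Real.rpow_mul (hT0 ω), hqq.sub_one_mul_conj]

/-- The scalar Stein inequality in `L^p(ℓ^s)` for `s ≤ p`. -/
theorem mixedNorm_condExp_le_of_le [LinearOrder ι] {p s : ℝ} (hs : 1 ≤ s) (hsp : s ≤ p)
    (S : Finset ι) {m : ι → MeasurableSpace Ω} (hm : ∀ i, m i ≤ mΩ) (hmono : MonotoneOn m S)
    {f : ι → Ω → ℝ} (hf : ∀ i, MemLp (f i) ∞ μ) :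
    mixedNorm μ p s S (fun i => μ[f i | m i]) ≤ (p / s) ^ (1 / s) * mixedNorm μ p s S f := by
  have hs0 : 0 < s := by linarith
  have hp0 : 0 < p := by linarith
  have hq : 1 ≤ p / s := (one_le_div hs0).2 hsp
  have hexp : 1 / p = 1 / (p / s) * (1 / s) := by field_simp
  set b : ι → Ω → ℝ := fun i ω => |f i ω| ^ s with hb
  have hbb : ∀ i, MemLp (b i) ∞ μ := fun i => (hf i).abs.rpow_const_top hs0.le
  have hb0 : ∀ i ω, 0 ≤ b i ω := fun i ω => Real.rpow_nonneg (abs_nonneg _) _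
  have hJ : ∀ᵐ ω ∂μ, ∀ i ∈ S, |(μ[f i | m i]) ω| ^ s ≤ |(μ[b i | m i]) ω| := by
    refine (Filter.eventually_all_finset S).2 fun i _ => ?_
    have hint : Integrable (fun ω => ‖f i ω‖ ^ s) μ := (hbb i).integrable le_top
    filter_upwards [Integrable.norm_condExp_rpow_le (m := m i) hs hint] with ω hω
    exact hω.trans (le_abs_self _)
  have hI0 : 0 ≤ ∫ ω, (∑ i ∈ S, b i ω) ^ (p / s) ∂μ :=
    integral_nonneg fun ω => Real.rpow_nonneg (Finset.sum_nonneg fun i _ => hb0 i ω) _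
  have hle : ∫ ω, (∑ i ∈ S, |(μ[f i | m i]) ω| ^ s) ^ (p / s) ∂μ ≤
      ∫ ω, (∑ i ∈ S, |(μ[b i | m i]) ω|) ^ (p / s) ∂μ := by
    refine integral_mono_of_nonneg
      (.of_forall fun ω => Real.rpow_nonneg (sum_abs_rpow_nonneg S _ s ω) _)
      ((MemLp.rpow_const_top (memLp_finsetSum S fun i _ =>
        ((hbb i).condExp (m := m i) le_top).abs) (by positivity)).integrable le_top) ?_
    filter_upwards [hJ] with ω hω
    exact Real.rpow_le_rpow (sum_abs_rpow_nonneg S _ s ω) (Finset.sum_le_sum hω) (by positivity)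
  have hle0 : 0 ≤ ∫ ω, (∑ i ∈ S, |(μ[f i | m i]) ω| ^ s) ^ (p / s) ∂μ :=
    integral_nonneg fun ω => Real.rpow_nonneg (sum_abs_rpow_nonneg S _ s ω) _
  unfold mixedNorm
  rw [hexp, Real.rpow_mul hle0, Real.rpow_mul hI0,
    ← Real.mul_rpow (by positivity) (Real.rpow_nonneg hI0 _)]
  refine Real.rpow_le_rpow (Real.rpow_nonneg hle0 _) ?_ (by positivity)
  exact (Real.rpow_le_rpow hle0 hle (by positivity)).trans
    (integral_sum_condExp_rpow_le hq S hm hmono hbb hb0)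

/-- Hölder's inequality in `L^p(ℓ^s)`. -/
theorem sum_integral_mul_le_mixedNorm_mul {p p' s s' : ℝ} (hp : p.HolderConjugate p')
    (hs : s.HolderConjugate s') (S : Finset ι) {f g : ι → Ω → ℝ}
    (hf : ∀ i, MemLp (f i) ∞ μ) (hg : ∀ i, MemLp (g i) ∞ μ) :
    ∑ i ∈ S, ∫ ω, f i ω * g i ω ∂μ ≤ mixedNorm μ p s S f * mixedNorm μ p' s' S g := by
  have hs0 := hs.pos
  have hs0' := hs.symm.pos
  have hF := memLp_top_sum_abs_rpow S hf hs0.le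
  have hG := memLp_top_sum_abs_rpow S hg hs0'.le
  have hF' := hF.rpow_const_top (r := 1 / s) (by positivity)
  have hG' := hG.rpow_const_top (r := 1 / s') (by positivity)
  have hint : ∀ i, Integrable (fun ω => f i ω * g i ω) μ := fun i =>
    ((hg i).mul (hf i)).integrable le_top
  rw [← integral_finsetSum _ fun i _ => hint i]
  have h1 : ∫ ω, ∑ i ∈ S, f i ω * g i ω ∂μ ≤
      ∫ ω, (∑ i ∈ S, |f i ω| ^ s) ^ (1 / s) * (∑ i ∈ S, |g i ω| ^ s') ^ (1 / s') ∂μ :=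
    integral_mono (integrable_finsetSum _ fun i _ => hint i) ((hG'.mul hF').integrable le_top)
      fun ω => Real.inner_le_Lp_mul_Lq S _ _ hs
  refine h1.trans ((integral_mul_le_Lp_mul_Lq_of_nonneg (μ := μ) hp
    (.of_forall fun ω => Real.rpow_nonneg (sum_abs_rpow_nonneg S f s ω) _)
    (.of_forall fun ω => Real.rpow_nonneg (sum_abs_rpow_nonneg S g s' ω) _)
    (hF'.mono_exponent le_top) (hG'.mono_exponent le_top)).trans_eq ?_)
  unfold mixedNorm
  simp_rw [← Real.rpow_mul (sum_abs_rpow_nonneg S f s _),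
    ← Real.rpow_mul (sum_abs_rpow_nonneg S g s' _), one_div_mul_eq_div]

/-- The scalar Stein inequality in `L^p(ℓ^s)` for `p < s`. -/
theorem mixedNorm_condExp_le_of_lt [LinearOrder ι] {p p' s s' : ℝ} (hp : p.HolderConjugate p')
    (hs : s.HolderConjugate s') (hps : p < s) (S : Finset ι) {m : ι → MeasurableSpace Ω}
    (hm : ∀ i, m i ≤ mΩ) (hmono : MonotoneOn m S) {f : ι → Ω → ℝ}
    (hf : ∀ i, MemLp (f i) ∞ μ) (hf0 : ∀ i ω, 0 ≤ f i ω) :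
    mixedNorm μ p s S (fun i => μ[f i | m i]) ≤ (p' / s') ^ (1 / s') * mixedNorm μ p s S f := by
  have hp0 := hp.pos
  have hs0 := hs.pos
  have hs0' := hs.symm.pos
  have hp0' := hp.symm.pos
  have hs1 := hs.lt
  have hp1 := hp.lt
  have hsp' : s' ≤ p' := by
    have h1 := hp.inv_add_inv_eq_one
    have h2 := hs.inv_add_inv_eq_one
    have h3 := inv_strictAnti₀ hp0 hps
    exact (inv_le_inv₀ hp0' hs0').1 (by linarith)
  have hps1 : p / s - 1 = (p - 1) / s - 1 / s' := by
    rw [one_div s', ← hs.one_sub_inv]; field_simp; ring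
  have hexp1 : 1 + (p / s - 1) * s' = (p - 1) / s * s' := by
    rw [hps1]; field_simp; ring
  have hexp0 : 1 + (p / s - 1) * s' ≠ 0 := by
    rw [hexp1]; exact (mul_pos (div_pos (by linarith) hs0) hs0').ne'
  have hexp : (1 + (p / s - 1) * s') * (p' / s') = p / s := by
    rw [hexp1]
    calc (p - 1) / s * s' * (p' / s') = (p - 1) * p' / s := by field_simp
      _ = p / s := by rw [hp.sub_one_mul_conj]
  set e : ι → Ω → ℝ := fun i => μ[f i | m i] with he
  have heb : ∀ i, MemLp (e i) ∞ μ := fun i => (hf i).condExp le_top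
  set T : Ω → ℝ := fun ω => ∑ i ∈ S, |e i ω| ^ s with hT
  have hT0 : ∀ ω, 0 ≤ T ω := sum_abs_rpow_nonneg S e s
  have hTb : MemLp T ∞ μ := memLp_top_sum_abs_rpow S heb hs0.le
  set g : ι → Ω → ℝ := fun i ω => if i ∈ S then |e i ω| ^ (s - 1) * T ω ^ (p / s - 1) else 0
    with hg
  have hgS : ∀ i ∈ S, g i = fun ω => |e i ω| ^ (s - 1) * T ω ^ (p / s - 1) := fun i hi => by
    ext ω; simp [hg, hi]
  have hgb : ∀ i, MemLp (g i) ∞ μ := fun i => by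
    by_cases hi : i ∈ S
    · rw [hgS i hi]
      refine (hTb.rpow_const_top (r := (p - 1) / s)
        (div_nonneg (by linarith) hs0.le)).mono ?_ (.of_forall fun ω => ?_)
      · exact (((heb i).abs.1.aemeasurable.pow_const _).mul
          (hTb.1.aemeasurable.pow_const _)).aestronglyMeasurable
      · rw [Real.norm_of_nonneg (mul_nonneg (Real.rpow_nonneg (abs_nonneg _) _)
          (Real.rpow_nonneg (hT0 ω) _)), Real.norm_of_nonneg (Real.rpow_nonneg (hT0 ω) _)]
        rcases (hT0 ω).eq_or_lt with h0 | h0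
        · rw [← h0, Real.zero_rpow (sub_neg.2 ((div_lt_one hs0).2 hps)).ne, mul_zero]
          exact Real.rpow_nonneg le_rfl _
        have h1 : |e i ω| ≤ T ω ^ (1 / s) := by
          rw [one_div, Real.le_rpow_inv_iff_of_pos (abs_nonneg _) (hT0 ω) hs0]
          exact Finset.single_le_sum (f := fun i => |e i ω| ^ s)
            (fun i _ => Real.rpow_nonneg (abs_nonneg _) _) hi
        calc |e i ω| ^ (s - 1) * T ω ^ (p / s - 1)
            ≤ (T ω ^ (1 / s)) ^ (s - 1) * T ω ^ (p / s - 1) :=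
              mul_le_mul_of_nonneg_right (Real.rpow_le_rpow (abs_nonneg _) h1 (by linarith))
                (Real.rpow_nonneg (hT0 ω) _)
          _ = T ω ^ ((p - 1) / s) := by
              rw [← Real.rpow_mul (hT0 ω), ← Real.rpow_add h0]
              congr 1; field_simp; ring
    · have : g i = 0 := by ext ω; simp [hg, hi]
      rw [this]; exact MemLp.zero
  have hI : ∫ ω, T ω ^ (p / s) ∂μ = ∑ i ∈ S, ∫ ω, f i ω * (μ[g i | m i]) ω ∂μ := by
    have hae : ∀ᵐ ω ∂μ, ∀ i ∈ S, 0 ≤ e i ω := (Filter.eventually_all_finset S).2 fun i _ =>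
      condExp_nonneg (.of_forall (hf0 i))
    calc ∫ ω, T ω ^ (p / s) ∂μ = ∫ ω, ∑ i ∈ S, e i ω * g i ω ∂μ := by
          refine integral_congr_ae ?_
          filter_upwards [hae] with ω hω
          rcases (hT0 ω).eq_or_lt with h0 | h0
          · rw [← h0, Real.zero_rpow (by positivity)]
            refine (Finset.sum_eq_zero fun i hi => ?_).symm
            rw [hgS i hi]
            simp only [← h0]
            rw [Real.zero_rpow (sub_neg.2 ((div_lt_one hs0).2 hps)).ne, mul_zero, mul_zero]
          · have h1 : ∀ i ∈ S, e i ω * g i ω = |e i ω| ^ s * T ω ^ (p / s - 1) := fun i hi => by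
              rw [hgS i hi, ← mul_assoc]
              congr 1
              rw [abs_of_nonneg (hω i hi)]
              rcases (hω i hi).eq_or_lt with h | h
              · rw [← h, zero_mul, Real.zero_rpow hs0.ne']
              · rw [Real.rpow_sub_one h.ne']; field_simp
            rw [Finset.sum_congr rfl h1, ← Finset.sum_mul]
            change _ = T ω * _
            rw [Real.rpow_sub_one h0.ne']; field_simp
      _ = ∑ i ∈ S, ∫ ω, e i ω * g i ω ∂μ :=
          integral_finsetSum _ fun i _ => ((hgb i).mul (heb i)).integrable le_top
      _ = _ := Finset.sum_congr rfl fun i _ => integral_condExp_mul_comm (hm i) (hf i) (hgb i)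
  have hgN : mixedNorm μ p' s' S g ≤ (∫ ω, T ω ^ (p / s) ∂μ) ^ (1 / p') := by
    unfold mixedNorm
    refine le_of_eq ?_
    congr 2
    ext ω
    rcases (hT0 ω).eq_or_lt with h0 | h0
    · have h1 : ∀ i ∈ S, |g i ω| ^ s' = 0 := fun i hi => by
        rw [hgS i hi]
        simp only [← h0]
        rw [Real.zero_rpow (sub_neg.2 ((div_lt_one hs0).2 hps)).ne, mul_zero, abs_zero,
          Real.zero_rpow hs0'.ne']
      rw [Finset.sum_eq_zero h1, ← h0, Real.zero_rpow (by positivity),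
        Real.zero_rpow (by positivity)]
    · have h1 : ∀ i ∈ S, |g i ω| ^ s' = |e i ω| ^ s * T ω ^ ((p / s - 1) * s') := fun i hi => by
        rw [hgS i hi]
        simp only
        rw [abs_of_nonneg (mul_nonneg (Real.rpow_nonneg (abs_nonneg _) _)
          (Real.rpow_nonneg (hT0 ω) _)), Real.mul_rpow (Real.rpow_nonneg (abs_nonneg _) _)
          (Real.rpow_nonneg (hT0 ω) _), ← Real.rpow_mul (abs_nonneg _), ← Real.rpow_mul (hT0 ω),
          hs.sub_one_mul_conj]
      rw [Finset.sum_congr rfl h1, ← Finset.sum_mul]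
      change (T ω * _) ^ _ = _
      rw [← Real.rpow_one_add' (hT0 ω) hexp0, ← Real.rpow_mul (hT0 ω), hexp]
  have hK : ∫ ω, T ω ^ (p / s) ∂μ ≤
      ((p' / s') ^ (1 / s') * mixedNorm μ p s S f) * (∫ ω, T ω ^ (p / s) ∂μ) ^ (1 / p') := by
    calc ∫ ω, T ω ^ (p / s) ∂μ ≤ mixedNorm μ p s S f * mixedNorm μ p' s' S fun i => μ[g i | m i] :=
          hI.le.trans (sum_integral_mul_le_mixedNorm_mul hp hs S hf
            fun i => (hgb i).condExp le_top)
      _ ≤ mixedNorm μ p s S f * ((p' / s') ^ (1 / s') * (∫ ω, T ω ^ (p / s) ∂μ) ^ (1 / p')) := by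
          refine mul_le_mul_of_nonneg_left ?_ (mixedNorm_nonneg _ _ _ _)
          exact (mixedNorm_condExp_le_of_le hs.symm.lt.le hsp' S hm hmono hgb).trans
            (mul_le_mul_of_nonneg_left hgN (by positivity))
      _ = _ := by ring
  exact Real.rpow_one_div_le_of_le_mul_rpow hp
    (integral_nonneg fun ω => Real.rpow_nonneg (hT0 ω) _)
    (mul_nonneg (by positivity) (mixedNorm_nonneg _ _ _ _)) hK

/-- The scalar Stein inequality in `L^p(ℓ^s)`. -/
theorem exists_mixedNorm_condExp_le {p s : ℝ} (hp : 1 < p) (hs : 1 ≤ s) :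
    ∃ C : ℝ, 0 < C ∧ ∀ {Ω ι : Type} {mΩ : MeasurableSpace Ω} {μ : Measure Ω}
      [IsProbabilityMeasure μ] [LinearOrder ι] (S : Finset ι) {m : ι → MeasurableSpace Ω},
      (∀ i, m i ≤ mΩ) → MonotoneOn m S → ∀ {f : ι → Ω → ℝ}, (∀ i, MemLp (f i) ∞ μ) →
      (∀ i ω, 0 ≤ f i ω) →
      mixedNorm μ p s S (fun i => μ[f i | m i]) ≤ C * mixedNorm μ p s S f := by
  rcases le_or_gt s p with hsp | hps
  · have : 0 < s := by linarith
    have : 0 < p := by linarith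
    exact ⟨(p / s) ^ (1 / s), by positivity, fun S _ hm hmono _ hf _ =>
      mixedNorm_condExp_le_of_le hs hsp S hm hmono hf⟩
  · have hpc := Real.HolderConjugate.conjExponent hp
    have hsc := Real.HolderConjugate.conjExponent (hp.trans hps)
    have := hpc.symm.pos
    have := hsc.symm.pos
    exact ⟨_, by positivity, fun S _ hm hmono _ hf hf0 =>
      mixedNorm_condExp_le_of_lt hpc hsc hps S hm hmono hf hf0⟩

end SteinInequality


/-- **Stein-type inequality for conditioned simple processes.**
Let `X` be a Banach space, `1 < p < ∞`, `1 ≤ s < ∞`, let `0 = t 1 < t 2 < … < t (l+1)`,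
let `ℱ` be a filtration indexed by `ℝ`, let `F i j k ∈ L^∞(Ω)`, `x i j k ∈ X`, and let
`w i j = (t (i+1) - t i) * ν j` with `ν j ≥ 0`. Then, with a constant depending only on
`p` and `s`,
`‖(∑_{i,j} w i j ‖∑_k E[F i j k | ℱ (t i)] x i j k‖^s)^{1/s}‖_{L^p(Ω)}
  ≤ C ‖(∑_{i,j} w i j ‖∑_k F i j k x i j k‖^s)^{1/s}‖_{L^p(Ω)}`. -/
theorem stein_conditioned_simple_process (p s : ℝ) (hp : 1 < p) (hs : 1 ≤ s) :
    ∃ C : ℝ, 0 < C ∧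
    ∀ (Ω : Type) (mΩ : MeasurableSpace Ω) (μ : Measure Ω), IsProbabilityMeasure μ →
    ∀ (X : Type) (_ : NormedAddCommGroup X), ∀ (_ : NormedSpace ℝ X),
    ∀ (ℱ : Filtration ℝ mΩ) (l m n : ℕ) (t : ℕ → ℝ),
      t 1 = 0 → (∀ i ∈ Finset.Icc 1 l, t i < t (i + 1)) →
    ∀ (F : ℕ → ℕ → ℕ → Ω → ℝ),
      (∀ i j k, Measurable (F i j k)) →
      (∀ i j k, ∃ c : ℝ, ∀ ω, |F i j k ω| ≤ c) →
    ∀ (x : ℕ → ℕ → ℕ → X) (ν : ℕ → ℝ), (∀ j, 0 ≤ ν j) →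
      (∫ ω, ((∑ i ∈ Finset.Icc 1 l, ∑ j ∈ Finset.Icc 1 m,
            ((t (i + 1) - t i) * ν j) *
              ‖∑ k ∈ Finset.Icc 1 n, (μ[F i j k | ℱ (t i)]) ω • x i j k‖ ^ s)
          ^ (1 / s)) ^ p ∂μ) ^ (1 / p)
        ≤ C * (∫ ω, ((∑ i ∈ Finset.Icc 1 l, ∑ j ∈ Finset.Icc 1 m,
            ((t (i + 1) - t i) * ν j) *
              ‖∑ k ∈ Finset.Icc 1 n, F i j k ω • x i j k‖ ^ s)
          ^ (1 / s)) ^ p ∂μ) ^ (1 / p) := by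
  obtain ⟨C, hC, hstein⟩ := exists_mixedNorm_condExp_le hp hs
  refine ⟨C, hC, ?_⟩
  intro Ω mΩ μ _ X _ _ ℱ l m n t _ ht F hFm hFb x ν hν
  have hs0 : 0 < s := by linarith
  have hp0 : 0 < p := by linarith
  have htm : MonotoneOn t (Set.Icc 1 l) :=
    monotoneOn_of_le_add_one Set.ordConnected_Icc fun i _ hi _ => (ht i (Finset.mem_Icc.2 hi)).le
  set S : Finset (ℕ ×ₗ ℕ) :=
    (Finset.Icc 1 l ×ˢ Finset.Icc 1 m).map toLex.toEmbedding with hS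
  have hsum : ∀ u : ℕ → ℕ → ℝ, ∑ i ∈ Finset.Icc 1 l, ∑ j ∈ Finset.Icc 1 m, u i j =
      ∑ a ∈ S, u (ofLex a).1 (ofLex a).2 := fun u => by
    rw [hS, Finset.sum_map, Finset.sum_product]; rfl
  set c : ℕ ×ₗ ℕ → ℝ := fun a =>
    |(t ((ofLex a).1 + 1) - t (ofLex a).1) * ν (ofLex a).2| ^ (1 / s) with hc
  have hc0 : ∀ a, 0 ≤ c a := fun a => Real.rpow_nonneg (abs_nonneg _) _
  have hw : ∀ i ∈ Finset.Icc 1 l, ∀ j, ∀ r : ℝ, 0 ≤ r →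
      (t (i + 1) - t i) * ν j * r ^ s = |c (toLex (i, j)) * r| ^ s := fun i hi j r hr => by
    have h0 : 0 ≤ (t (i + 1) - t i) * ν j := mul_nonneg (sub_nonneg.2 (ht i hi).le) (hν j)
    rw [abs_of_nonneg (mul_nonneg (hc0 _) hr), Real.mul_rpow (hc0 _) hr]
    simp only [hc, ofLex_toLex]
    rw [abs_of_nonneg h0, ← Real.rpow_mul h0, one_div_mul_cancel hs0.ne', Real.rpow_one]
  have hmix : ∀ u : ℕ → ℕ → Ω → ℝ, (∀ i j ω, 0 ≤ u i j ω) →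
      (∫ ω, ((∑ i ∈ Finset.Icc 1 l, ∑ j ∈ Finset.Icc 1 m,
        ((t (i + 1) - t i) * ν j) * u i j ω ^ s) ^ (1 / s)) ^ p ∂μ) ^ (1 / p) =
      mixedNorm μ p s S fun a ω => c a * u (ofLex a).1 (ofLex a).2 ω := fun u hu => by
    unfold mixedNorm
    congr 2
    ext ω
    rw [Finset.sum_congr rfl fun i hi => Finset.sum_congr rfl fun j _ => hw i hi j _ (hu i j ω),
      hsum fun i j => |c (toLex (i, j)) * u i j ω| ^ s,
      ← Real.rpow_mul (Finset.sum_nonneg fun a _ => Real.rpow_nonneg (abs_nonneg _) _),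
      one_div_mul_eq_div]
    rfl
  have hFL : ∀ i j k, MemLp (F i j k) ∞ μ := fun i j k => by
    obtain ⟨b, hb⟩ := hFb i j k
    exact memLp_top_of_bound (hFm i j k).aestronglyMeasurable b (.of_forall hb)
  set f : ℕ ×ₗ ℕ → Ω → ℝ := fun a ω => c a * ‖∑ k ∈ Finset.Icc 1 n,
    F (ofLex a).1 (ofLex a).2 k ω • x (ofLex a).1 (ofLex a).2 k‖ with hf
  have hfL : ∀ a, MemLp (f a) ∞ μ := fun a => by
    have hterm : ∀ k, MemLp (fun ω => F (ofLex a).1 (ofLex a).2 k ω •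
        x (ofLex a).1 (ofLex a).2 k) ∞ μ := fun k =>
      ((ContinuousLinearMap.id ℝ ℝ).smulRight (x (ofLex a).1 (ofLex a).2 k)).comp_memLp'
        (hFL (ofLex a).1 (ofLex a).2 k)
    have hnorm := (memLp_finsetSum (Finset.Icc 1 n) fun k _ => hterm k).norm
    exact hnorm.const_mul (c a)
  have hf0 : ∀ a ω, 0 ≤ f a ω := fun a ω => mul_nonneg (hc0 a) (norm_nonneg _)
  rw [hmix _ fun i j ω => norm_nonneg _, hmix _ fun i j ω => norm_nonneg _]
  have hmono : MonotoneOn (fun a : ℕ ×ₗ ℕ => (ℱ (t (ofLex a).1) : MeasurableSpace Ω)) S := by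
    intro a ha b hb hab
    have hmem : ∀ a ∈ S, (ofLex a).1 ∈ Set.Icc 1 l := fun a ha => by
      obtain ⟨d, hd, rfl⟩ := Finset.mem_map.1 ha
      exact Finset.mem_Icc.1 (Finset.mem_product.1 hd).1
    exact ℱ.mono (htm (hmem a ha) (hmem b hb) (Prod.Lex.monotone_fst _ _ hab))
  refine le_trans (mixedNorm_mono hp0 hs0 S (fun a => (hfL a).condExp le_top) fun a => ?_)
    (hstein S (fun a => ℱ.le _) hmono hfL hf0)
  filter_upwards [norm_sum_condExp_smul_le (ℱ (t (ofLex a).1)) (Finset.Icc 1 n)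
      (fun k => (hFL (ofLex a).1 (ofLex a).2 k).integrable le_top)
      (fun k => x (ofLex a).1 (ofLex a).2 k),
    condExp_smul (μ := μ) (c a) (fun ω => ‖∑ k ∈ Finset.Icc 1 n,
      F (ofLex a).1 (ofLex a).2 k ω • x (ofLex a).1 (ofLex a).2 k‖) (ℱ (t (ofLex a).1))]
    with ω h1 h2
  rw [abs_of_nonneg (mul_nonneg (hc0 a) (norm_nonneg _))]
  refine (mul_le_mul_of_nonneg_left h1 (hc0 a)).trans ((le_of_eq ?_).trans (le_abs_self _))
  exact h2.symm
end

section
/- Itô isomorphism in Hilbert spaces, case 2 ≤ p < ∞: Let H be a Hilbert space and 2 ≤ p < ∞. In the discrete model of the Poisson stochastic integral with X = H, there exist constants c, C > 0 depending only on p such that c · max{ (E(∑_{i=1}^n λ_i ‖y_i‖_H^2)^{p/2})^{1/p}, (∑_{i=1}^n λ_i E‖y_i‖_H^p)^{1/p} } ≤ (E max_{1≤m≤n} ‖ ∑_{i=1}^m Ñ_i y_i ‖_H^p)^{1/p} ≤ C · max{ (E(∑_{i=1}^n λ_i ‖y_i‖_H^2)^{p/2})^{1/p}, (∑_{i=1}^n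 λ_i E‖y_i‖_H^p)^{1/p} }. -/
open MeasureTheory ProbabilityTheory
open scoped ENNReal NNReal

section Scalar

/-- The graph of `t ↦ t ^ q` on `[0, ∞)` lies above its tangents when `1 ≤ q`. -/
theorem rpow_add_mul_sub_le_rpow {x y q : ℝ} (hx : 0 ≤ x) (hy : 0 ≤ y) (hq : 1 ≤ q) :
    x ^ q + q * x ^ (q - 1) * (y - x) ≤ y ^ q := by
  rcases hx.eq_or_lt with rfl | hx
  · rcases hq.eq_or_lt with rfl | hq
    · simp
    · rw [Real.zero_rpow (by linarith), Real.zero_rpow (by linarith)]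
      simpa using Real.rpow_nonneg hy q
  · have hb := one_add_mul_self_le_rpow_one_add (s := y / x - 1)
      (by linarith [div_nonneg hy hx.le]) hq
    rw [add_sub_cancel, Real.div_rpow hy hx.le, le_div_iff₀ (Real.rpow_pos_of_pos hx q)] at hb
    refine le_trans (le_of_eq ?_) hb
    rw [Real.rpow_sub_one hx.ne']
    field_simp

theorem rpow_sub_one_mul_self {x q : ℝ} (hx : 0 ≤ x) (hq : q ≠ 0) : x ^ (q - 1) * x = x ^ q := by
  rw [← Real.rpow_add_one' hx (by simpa using hq), sub_add_cancel]

/-- A form of Young's inequality with an arbitrarily small constant in front of one term. -/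
theorem exists_rpow_sub_one_mul_le {q ε : ℝ} (hq : 1 ≤ q) (hε : 0 < ε) :
    ∃ K : ℝ, 0 < K ∧ ∀ x y : ℝ, 0 ≤ x → 0 ≤ y → x ^ (q - 1) * y ≤ ε * x ^ q + K * y ^ q := by
  refine ⟨(ε⁻¹) ^ (q - 1), by positivity, fun x y hx hy => ?_⟩
  rcases le_total y (ε * x) with h | h
  · calc x ^ (q - 1) * y ≤ x ^ (q - 1) * (ε * x) := by gcongr
      _ = ε * x ^ q := by rw [← rpow_sub_one_mul_self (q := q) hx (by linarith)]; ring
      _ ≤ _ := le_add_of_nonneg_right (by positivity)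
  · have hxy : x ≤ ε⁻¹ * y := by rwa [inv_mul_eq_div, le_div_iff₀' hε]
    calc x ^ (q - 1) * y ≤ (ε⁻¹ * y) ^ (q - 1) * y := by
          gcongr
      _ = (ε⁻¹) ^ (q - 1) * y ^ q := by
          rw [Real.mul_rpow (by positivity) hy, mul_assoc, rpow_sub_one_mul_self hy (by linarith)]
      _ ≤ _ := le_add_of_nonneg_left (by positivity)

theorem sq_rpow_half {x : ℝ} (hx : 0 ≤ x) (p : ℝ) : (x ^ 2) ^ (p / 2) = x ^ p := by
  rw [← Real.rpow_natCast, ← Real.rpow_mul hx]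
  congr 1
  push_cast
  ring

theorem sq_rpow_half_sub_one {x : ℝ} (hx : 0 ≤ x) (p : ℝ) :
    (x ^ 2) ^ (p / 2 - 1) = x ^ (p - 2) := by
  rw [← sq_rpow_half hx (p - 2)]
  congr 1
  ring

theorem add_rpow_le_two_rpow_mul {x y r : ℝ} (hx : 0 ≤ x) (hy : 0 ≤ y) (hr : 0 ≤ r) :
    (x + y) ^ r ≤ 2 ^ r * (x ^ r + y ^ r) := by
  wlog h : y ≤ x generalizing x y
  · rw [add_comm x, add_comm (x ^ r)]
    exact this hy hx (le_of_not_ge h)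
  calc (x + y) ^ r ≤ (2 * x) ^ r := by gcongr; linarith
    _ = 2 ^ r * x ^ r := Real.mul_rpow (by norm_num) hx
    _ ≤ _ := by gcongr; exact le_add_of_nonneg_right (by positivity)

theorem rpow_sub_rpow_mul_sq_sub_sq_le {x y r : ℝ} (hx : 0 ≤ x) (hxy : x ≤ y) (hr : 0 ≤ r) :
    (y ^ r - x ^ r) * (y ^ 2 - x ^ 2) ≤ 2 * (r + 1) * (y ^ r * (y - x) ^ 2) := by
  have hy : 0 ≤ y := hx.trans hxy
  have hx1 : x ^ (r + 1) = x ^ r * x := Real.rpow_add_one' hx (by linarith)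
  have hy1 : y ^ (r + 1) = y ^ r * y := Real.rpow_add_one' hy (by linarith)
  have hle : x ^ r ≤ y ^ r := by gcongr
  have ht := rpow_add_mul_sub_le_rpow hy hx (q := r + 1) (by linarith)
  rw [add_sub_cancel_right, hx1, hy1] at ht
  have hsum : (y ^ r - x ^ r) * (y + x) ≤ 2 * (r + 1) * (y ^ r * (y - x)) := by
    nlinarith [mul_nonneg (Real.rpow_nonneg hy r) (sub_nonneg.2 hxy),
      mul_nonneg (Real.rpow_nonneg hx r) (sub_nonneg.2 hxy)]
  calc (y ^ r - x ^ r) * (y ^ 2 - x ^ 2) = (y ^ r - x ^ r) * (y + x) * (y - x) := by ring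
    _ ≤ 2 * (r + 1) * (y ^ r * (y - x)) * (y - x) :=
        mul_le_mul_of_nonneg_right hsum (sub_nonneg.2 hxy)
    _ = _ := by ring

theorem rpow_sub_rpow_mul_sq_sub_sq_le_of_abs_sub_le {x y b r : ℝ} (hx : 0 ≤ x) (hy : 0 ≤ y)
    (hb : |y - x| ≤ b) (hr : 0 ≤ r) :
    (y ^ r - x ^ r) * (y ^ 2 - x ^ 2)
      ≤ 2 * (r + 1) * 2 ^ r * (x ^ r * b ^ 2 + b ^ (r + 2)) := by
  have hb0 : 0 ≤ b := (abs_nonneg _).trans hb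
  have hb2 : (y - x) ^ 2 ≤ b ^ 2 := sq_le_sq' (by linarith [(abs_le.1 hb).1]) (abs_le.1 hb).2
  have hmax : (y ^ r - x ^ r) * (y ^ 2 - x ^ 2) ≤ 2 * (r + 1) * ((x + b) ^ r * b ^ 2) := by
    rcases le_total x y with h | h
    · refine (rpow_sub_rpow_mul_sq_sub_sq_le hx h hr).trans ?_
      gcongr
      linarith [(abs_le.1 hb).2]
    · have := rpow_sub_rpow_mul_sq_sub_sq_le hy h hr
      calc _ = (x ^ r - y ^ r) * (x ^ 2 - y ^ 2) := by ring
        _ ≤ _ := this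
        _ ≤ _ := by
          rw [show (x - y) ^ 2 = (y - x) ^ 2 by ring]
          gcongr
          linarith
  have hbr : b ^ (r + 2) = b ^ r * b ^ 2 := by
    rw [Real.rpow_add' hb0 (by linarith)]
    norm_cast
  calc _ ≤ _ := hmax
    _ ≤ 2 * (r + 1) * (2 ^ r * (x ^ r + b ^ r) * b ^ 2) := by
      gcongr
      exact add_rpow_le_two_rpow_mul hx hb0 hr
    _ = _ := by rw [hbr]; ring

/-- The pathwise inequality behind Doob's maximal inequality in `L^p`. -/
theorem doob_step {s x p : ℝ} (hs : 0 ≤ s) (hx : 0 ≤ x) (hp : 1 ≤ p) :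
    p * (s ^ (p - 1) * x) - (p - 1) * s ^ p
      ≤ p * ((s ⊔ x) ^ (p - 1) * x) - (p - 1) * (s ⊔ x) ^ p := by
  rcases le_total x s with h | h
  · rw [sup_eq_left.2 h]
  · have ht := rpow_add_mul_sub_le_rpow hs hx hp
    have hs' := rpow_sub_one_mul_self hs (q := p) (by linarith)
    rw [sup_eq_right.2 h, rpow_sub_one_mul_self hx (by linarith)]
    have : p * s ^ (p - 1) * (x - s) = p * (s ^ (p - 1) * x) - p * s ^ p := by
      rw [← hs']
      ring
    linarith

theorem rpow_mul_sub_rpow_step {a b x x' q : ℝ} (ha : 0 ≤ a) (hb : 0 ≤ b) (hx : 0 ≤ x)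
    (hq : 1 ≤ q) :
    q * (a ^ (q - 1) * x) - a ^ q + q * ((a + b) ^ (q - 1) * (x' - x - b))
      ≤ q * ((a + b) ^ (q - 1) * x') - (a + b) ^ q := by
  have ht := rpow_add_mul_sub_le_rpow (add_nonneg ha hb) ha hq
  have hm : q * (a ^ (q - 1) * x) ≤ q * ((a + b) ^ (q - 1) * x) := by
    gcongr
    linarith
  linarith

end Scalar

section Hilbert

variable {H : Type*} [NormedAddCommGroup H] [InnerProductSpace ℝ H]

/-- The function `‖·‖ ^ p` lies above its tangents when `2 ≤ p`. -/
theorem norm_rpow_add_inner_le (a b : H) {p : ℝ} (hp : 2 ≤ p) :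
    ‖a‖ ^ p + p * (‖a‖ ^ (p - 2) * inner ℝ a b) ≤ ‖a + b‖ ^ p := by
  have h := rpow_add_mul_sub_le_rpow (sq_nonneg ‖a‖) (sq_nonneg ‖a + b‖)
    (show 1 ≤ p / 2 by linarith)
  rw [sq_rpow_half (norm_nonneg _), sq_rpow_half (norm_nonneg _),
    sq_rpow_half_sub_one (norm_nonneg _), norm_add_sq_real] at h
  have : 0 ≤ p / 2 * ‖a‖ ^ (p - 2) * ‖b‖ ^ 2 := by positivity
  linarith

/-- Clarkson's inequality in an inner product space. -/
theorem norm_rpow_add_norm_rpow_le (a b : H) {p : ℝ} (hp : 2 ≤ p) :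
    2 * (‖a‖ ^ p + ‖b‖ ^ p) ≤ ‖a + b‖ ^ p + ‖a - b‖ ^ p := by
  have hq : 1 ≤ p / 2 := by linarith
  have hpar := parallelogram_law_with_norm ℝ a b
  have h₀ : 0 ≤ ‖a‖ ^ 2 + ‖b‖ ^ 2 := by positivity
  have h₁ := rpow_add_mul_sub_le_rpow h₀ (sq_nonneg ‖a + b‖) hq
  have h₂ := rpow_add_mul_sub_le_rpow h₀ (sq_nonneg ‖a - b‖) hq
  have h₃ := Real.add_rpow_le_rpow_add (sq_nonneg ‖a‖) (sq_nonneg ‖b‖) hq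
  rw [sq_rpow_half (norm_nonneg _)] at h₁ h₂
  rw [sq_rpow_half (norm_nonneg _), sq_rpow_half (norm_nonneg _)] at h₃
  have h₄ : p / 2 * (‖a‖ ^ 2 + ‖b‖ ^ 2) ^ (p / 2 - 1) *
      (‖a + b‖ ^ 2 - (‖a‖ ^ 2 + ‖b‖ ^ 2) + (‖a - b‖ ^ 2 - (‖a‖ ^ 2 + ‖b‖ ^ 2))) = 0 := by
    rw [mul_eq_zero]
    right
    linarith
  linarith

/-- A quantitative form of the uniform convexity of `‖·‖ ^ p` for `2 ≤ p`. -/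
theorem norm_rpow_add_inner_add_le (a b : H) {p : ℝ} (hp : 2 ≤ p) :
    ‖a‖ ^ p + p * (‖a‖ ^ (p - 2) * inner ℝ a b) + 2 * (1 / 2) ^ p * ‖b‖ ^ p ≤ ‖a + b‖ ^ p := by
  have h₁ := norm_rpow_add_norm_rpow_le (a + (1 / 2 : ℝ) • b) ((1 / 2 : ℝ) • b) hp
  have h₂ := norm_rpow_add_inner_le a ((1 / 2 : ℝ) • b) hp
  rw [inner_smul_right] at h₂
  rw [add_sub_cancel_right, add_assoc, ← add_smul, add_halves, one_smul,
    norm_smul, Real.mul_rpow (norm_nonneg _) (norm_nonneg _),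
    Real.norm_of_nonneg (by norm_num : (0 : ℝ) ≤ 1 / 2)] at h₁
  linarith

/-- Second order upper Taylor estimate for `‖·‖ ^ p`, `2 ≤ p`. -/
theorem norm_add_rpow_le (a b : H) {p : ℝ} (hp : 2 ≤ p) :
    ‖a + b‖ ^ p ≤ ‖a‖ ^ p + p * (‖a‖ ^ (p - 2) * inner ℝ a b)
      + (p / 2 + p * (p - 1) * 2 ^ (p - 2)) * (‖a‖ ^ (p - 2) * ‖b‖ ^ 2 + ‖b‖ ^ p) := by
  have h := rpow_add_mul_sub_le_rpow (sq_nonneg ‖a + b‖) (sq_nonneg ‖a‖)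
    (show 1 ≤ p / 2 by linarith)
  rw [sq_rpow_half (norm_nonneg _), sq_rpow_half (norm_nonneg _),
    sq_rpow_half_sub_one (norm_nonneg _)] at h
  have hr := rpow_sub_rpow_mul_sq_sub_sq_le_of_abs_sub_le (norm_nonneg a) (norm_nonneg (a + b))
    (b := ‖b‖) (by simpa using abs_norm_sub_norm_le (a + b) a) (show 0 ≤ p - 2 by linarith)
  rw [sub_add_cancel, show p - 2 + 1 = p - 1 by ring] at hr
  have hr' := mul_le_mul_of_nonneg_left hr (show 0 ≤ p / 2 by linarith)
  have hsq : ‖a + b‖ ^ 2 - ‖a‖ ^ 2 = 2 * inner ℝ a b + ‖b‖ ^ 2 := by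
    rw [norm_add_sq_real]
    ring
  have hb : 0 ≤ p / 2 * ‖b‖ ^ p := by positivity
  calc ‖a + b‖ ^ p
      ≤ ‖a‖ ^ p + p / 2 * (‖a‖ ^ (p - 2) * (‖a + b‖ ^ 2 - ‖a‖ ^ 2))
        + p / 2 * ((‖a + b‖ ^ (p - 2) - ‖a‖ ^ (p - 2)) * (‖a + b‖ ^ 2 - ‖a‖ ^ 2)) := by linarith
    _ ≤ ‖a‖ ^ p + p / 2 * (‖a‖ ^ (p - 2) * (2 * inner ℝ a b + ‖b‖ ^ 2)) +
        p / 2 * (2 * (p - 1) * 2 ^ (p - 2) * (‖a‖ ^ (p - 2) * ‖b‖ ^ 2 + ‖b‖ ^ p)) := by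
      rw [hsq] at hr' ⊢
      linarith
    _ ≤ _ := by linarith

theorem norm_add_inv_norm_mul_inner_le (a b : H) :
    ‖a‖ + ‖a‖⁻¹ * inner ℝ a b ≤ ‖a + b‖ := by
  rcases eq_or_ne a 0 with rfl | ha
  · simp
  have ha' : 0 < ‖a‖ := norm_pos_iff.2 ha
  have h := real_inner_le_norm a (a + b)
  rw [inner_add_right, real_inner_self_eq_norm_sq] at h
  refine le_of_mul_le_mul_left ?_ ha'
  rw [mul_add, mul_inv_cancel_left₀ ha'.ne']
  linarith

end Hilbert

section Poisson

theorem summable_inv_factorial_mul_rpow (s : ℝ) :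
    Summable fun n : ℕ => (n.factorial : ℝ)⁻¹ * ((n : ℝ) + 1) ^ s := by
  obtain ⟨k, hk⟩ := exists_nat_ge s
  have hsum := (Real.summable_pow_div_factorial (Real.exp 1)).mul_left
    (Real.exp 1 * k.factorial)
  refine hsum.of_nonneg_of_le (fun n => by positivity) fun n => ?_
  have h₁ : ((n : ℝ) + 1) ^ s ≤ ((n : ℝ) + 1) ^ k := by
    rw [← Real.rpow_natCast]
    exact Real.rpow_le_rpow_of_exponent_le (by linarith [n.cast_nonneg (α := ℝ)]) hk
  have h₂ := Real.pow_div_factorial_le_exp ((n : ℝ) + 1) (by positivity) k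
  rw [div_le_iff₀ (by positivity)] at h₂
  have h₃ : Real.exp ((n : ℝ) + 1) = Real.exp 1 ^ n * Real.exp 1 := by
    rw [Real.exp_add, ← Real.exp_nat_mul, mul_one]
  rw [h₃] at h₂
  calc (n.factorial : ℝ)⁻¹ * ((n : ℝ) + 1) ^ s
      ≤ (n.factorial : ℝ)⁻¹ * (Real.exp 1 ^ n * Real.exp 1 * k.factorial) := by
        gcongr
        exact h₁.trans h₂
    _ = _ := by ring

variable {l : ℝ≥0}

theorem poisson_weight_le (hl : l ≤ 1) (n : ℕ) :
    Real.exp (-l) * l ^ n / n.factorial ≤ (n.factorial : ℝ)⁻¹ := by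
  have h₁ : Real.exp (-l) ≤ 1 := by simp
  have h₂ : (l : ℝ) ^ n ≤ 1 := pow_le_one₀ l.2 (by exact_mod_cast hl)
  rw [div_eq_mul_inv]
  exact mul_le_of_le_one_left (by positivity) (mul_le_one₀ h₁ (by positivity) h₂)

/-- A function of polynomial growth is integrable for a Poisson measure of rate at most `1`. -/
theorem integrable_poissonMeasure_of_norm_le (hl : l ≤ 1) {f : ℕ → ℝ} {s : ℝ}
    (hf : ∀ n, ‖f n‖ ≤ ((n : ℝ) + 1) ^ s) : Integrable f (poissonMeasure l) := by
  rw [integrable_poissonMeasure_iff]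
  refine (summable_inv_factorial_mul_rpow s).of_nonneg_of_le (fun n => by positivity) fun n => ?_
  gcongr
  · exact poisson_weight_le hl n
  · exact hf n

/-- The Stein-Chen identity for the Poisson distribution. -/
theorem integral_natCast_mul_poissonMeasure {f : ℕ → ℝ}
    (hf : Integrable (fun n : ℕ => n * f n) (poissonMeasure l)) :
    ∫ n : ℕ, n * f n ∂poissonMeasure l = l * ∫ n, f (n + 1) ∂poissonMeasure l := by
  rw [integral_poissonMeasure, integral_poissonMeasure, ← tsum_mul_left,
    (hasSum_integral_poissonMeasure hf).summable.tsum_eq_zero_add]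
  simp only [Nat.cast_zero, zero_mul, mul_zero, zero_add, smul_eq_mul]
  congr with n
  rw [Nat.factorial_succ, pow_succ]
  push_cast
  field_simp

theorem norm_natCast_sub_le (hl : l ≤ 1) (n : ℕ) : ‖(n : ℝ) - l‖ ≤ (n : ℝ) + 1 := by
  have h₁ : (l : ℝ) ≤ 1 := by exact_mod_cast hl
  rw [Real.norm_eq_abs, abs_le]
  constructor <;> linarith [l.2, n.cast_nonneg (α := ℝ)]

theorem integrable_natCast_poissonMeasure (hl : l ≤ 1) :
    Integrable (fun n : ℕ => (n : ℝ)) (poissonMeasure l) :=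
  integrable_poissonMeasure_of_norm_le (s := 1) hl fun n => by simp

theorem integral_natCast_poissonMeasure (hl : l ≤ 1) :
    ∫ n : ℕ, (n : ℝ) ∂poissonMeasure l = l := by
  simpa using integral_natCast_mul_poissonMeasure (f := fun _ => 1)
    (by simpa using integrable_natCast_poissonMeasure hl)

theorem integral_natCast_sub_poissonMeasure (hl : l ≤ 1) :
    ∫ n : ℕ, ((n : ℝ) - l) ∂poissonMeasure l = 0 := by
  rw [integral_sub (integrable_natCast_poissonMeasure hl) (integrable_const _),
    integral_natCast_poissonMeasure hl]
  simp

theorem integral_natCast_sub_sq_poissonMeasure (hl : l ≤ 1) :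
    ∫ n : ℕ, ((n : ℝ) - l) ^ 2 ∂poissonMeasure l = l := by
  have h₁ := integrable_natCast_poissonMeasure hl
  have h₂ : Integrable (fun n : ℕ => (n : ℝ) * n) (poissonMeasure l) :=
    integrable_poissonMeasure_of_norm_le (s := 2) hl fun n => by
      rw [norm_mul, Real.norm_natCast, Real.rpow_two]
      nlinarith [n.cast_nonneg (α := ℝ)]
  have h₃ := integral_natCast_mul_poissonMeasure h₂
  have h₄ : ∀ n : ℕ, ((n : ℝ) - l) ^ 2 = n * n - 2 * l * n + l ^ 2 := fun n => by ring
  simp only [h₄]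
  have h₅ := integral_add (h₂.sub (h₁.const_mul (2 * (l : ℝ)))) (integrable_const ((l : ℝ) ^ 2))
  simp only [Pi.sub_apply] at h₅
  rw [h₅, integral_sub h₂ (h₁.const_mul _), integral_const_mul, h₃,
    integral_natCast_poissonMeasure hl]
  push_cast
  rw [integral_add h₁ (integrable_const _), integral_natCast_poissonMeasure hl]
  simp
  ring

theorem integrable_abs_natCast_sub_rpow_poissonMeasure (hl : l ≤ 1) {p : ℝ} (hp : 0 ≤ p) :
    Integrable (fun n : ℕ => |(n : ℝ) - l| ^ p) (poissonMeasure l) :=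
  integrable_poissonMeasure_of_norm_le hl fun n => by
    rw [Real.norm_of_nonneg (by positivity)]
    gcongr
    exact norm_natCast_sub_le hl n

/-- The centred `p`-th absolute moment of a Poisson variable of rate `l ≤ 1` is at most of
order `l`. -/
theorem exists_integral_abs_natCast_sub_rpow_le {p : ℝ} (hp : 2 ≤ p) :
    ∃ K : ℝ, 0 < K ∧ ∀ l : ℝ≥0, l ≤ 1 →
      ∫ n : ℕ, |(n : ℝ) - l| ^ p ∂poissonMeasure l ≤ K * l := by
  have hp0 : 0 ≤ p := by linarith
  have hsum := summable_inv_factorial_mul_rpow p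
  refine ⟨1 + ∑' n : ℕ, (n.factorial : ℝ)⁻¹ * ((n : ℝ) + 1) ^ p, ?_, fun l hl => ?_⟩
  · have : 0 ≤ ∑' n : ℕ, (n.factorial : ℝ)⁻¹ * ((n : ℝ) + 1) ^ p :=
      tsum_nonneg fun n => by positivity
    linarith
  have hl' : (l : ℝ) ≤ 1 := by exact_mod_cast hl
  have hint : Integrable (fun n : ℕ => (n : ℝ) * (n : ℝ) ^ p) (poissonMeasure l) :=
    integrable_poissonMeasure_of_norm_le (s := p + 1) hl fun n => by
      rw [Real.norm_of_nonneg (by positivity), mul_comm,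
        ← Real.rpow_add_one' n.cast_nonneg (by linarith)]
      gcongr
      linarith
  have hshift : ∫ n : ℕ, ((n + 1 : ℕ) : ℝ) ^ p ∂poissonMeasure l
      ≤ ∑' n : ℕ, (n.factorial : ℝ)⁻¹ * ((n : ℝ) + 1) ^ p := by
    have hi : Integrable (fun n : ℕ => ((n + 1 : ℕ) : ℝ) ^ p) (poissonMeasure l) :=
      integrable_poissonMeasure_of_norm_le (s := p) hl fun n => by
        rw [Real.norm_of_nonneg (by positivity)]
        simp
    refine hasSum_le (fun n => ?_) (hasSum_integral_poissonMeasure hi) hsum.hasSum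
    rw [smul_eq_mul, Nat.cast_add_one]
    gcongr
    exact poisson_weight_le hl n
  calc ∫ n : ℕ, |(n : ℝ) - l| ^ p ∂poissonMeasure l
      ≤ ∫ n : ℕ, (l + n * (n : ℝ) ^ p) ∂poissonMeasure l := by
        refine integral_mono (integrable_abs_natCast_sub_rpow_poissonMeasure hl hp0)
          ((integrable_const _).add hint) fun n => ?_
        rcases n.eq_zero_or_pos with rfl | hn
        · simp only [Nat.cast_zero, zero_sub, abs_neg, zero_mul, add_zero, NNReal.abs_eq]
          calc (l : ℝ) ^ p ≤ (l : ℝ) ^ (1 : ℝ) :=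
                Real.rpow_le_rpow_of_exponent_ge_of_imp l.2 hl' (by linarith)
                  (fun _ h => by linarith)
            _ = l := Real.rpow_one _
        · have hn' : (1 : ℝ) ≤ n := by exact_mod_cast hn
          calc |(n : ℝ) - l| ^ p ≤ (n : ℝ) ^ p := by
                gcongr
                rw [abs_le]
                constructor <;> linarith [l.2]
            _ ≤ n * (n : ℝ) ^ p := le_mul_of_one_le_left (by positivity) hn'
            _ ≤ _ := le_add_of_nonneg_left l.2
    _ = l + l * ∫ n : ℕ, ((n + 1 : ℕ) : ℝ) ^ p ∂poissonMeasure l := by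
        rw [integral_add (integrable_const _) hint, integral_natCast_mul_poissonMeasure hint]
        simp
    _ ≤ l + l * ∑' n : ℕ, (n.factorial : ℝ)⁻¹ * ((n : ℝ) + 1) ^ p := by gcongr
    _ = _ := by ring

/-- The centred `p`-th absolute moment of a Poisson variable of rate `l ≤ 1` is at least of
order `l`. -/
theorem mul_le_integral_abs_natCast_sub_rpow {p : ℝ} (hp : 0 ≤ p) (hl : l ≤ 1) :
    Real.exp (-1) * (1 / 2) ^ p * l ≤ ∫ n : ℕ, |(n : ℝ) - l| ^ p ∂poissonMeasure l := by
  have hs := hasSum_integral_poissonMeasure (integrable_abs_natCast_sub_rpow_poissonMeasure hl hp)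
  have hterm (n : ℕ) := le_hasSum hs n fun m _ => smul_nonneg (by positivity) (by positivity)
  have hl' : (l : ℝ) ≤ 1 := by exact_mod_cast hl
  have hexp : Real.exp (-1) ≤ Real.exp (-l) := Real.exp_le_exp.2 (by linarith)
  rcases le_total (l : ℝ) (1 / 2) with h | h
  · refine le_trans ?_ (hterm 1)
    have : (1 / 2 : ℝ) ≤ |1 - (l : ℝ)| := by
      rw [abs_of_nonneg (by linarith)]
      linarith
    simp only [pow_one, Nat.factorial_one, Nat.cast_one, div_one, smul_eq_mul]
    calc Real.exp (-1) * (1 / 2) ^ p * l = Real.exp (-1) * l * (1 / 2) ^ p := by ring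
      _ ≤ _ := by gcongr
  · refine le_trans ?_ (hterm 0)
    simp only [pow_zero, Nat.factorial_zero, Nat.cast_one, div_one, smul_eq_mul, mul_one,
      Nat.cast_zero, zero_sub, abs_neg, NNReal.abs_eq]
    calc Real.exp (-1) * (1 / 2) ^ p * l ≤ Real.exp (-1) * (1 / 2) ^ p :=
          mul_le_of_le_one_right (by positivity) hl'
      _ ≤ _ := by gcongr

end Poisson

section AllMoments

variable {Ω E : Type*} {mΩ : MeasurableSpace Ω} {μ : Measure Ω} [NormedAddCommGroup E]

/-- A function has all moments if it belongs to `L^r` for all finite `r`. -/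
def HasAllMoments (f : Ω → E) (μ : Measure Ω) : Prop :=
  ∀ r : ℝ≥0, MemLp f r μ

namespace HasAllMoments

theorem integrable {f : Ω → E} (hf : HasAllMoments f μ) : Integrable f μ :=
  memLp_one_iff_integrable.1 (by simpa using hf 1)

theorem aestronglyMeasurable {f : Ω → E} (hf : HasAllMoments f μ) : AEStronglyMeasurable f μ :=
  (hf 0).1

theorem of_bound [IsFiniteMeasure μ] {f : Ω → E} (hf : AEStronglyMeasurable f μ) (C : ℝ)
    (hC : ∀ ω, ‖f ω‖ ≤ C) : HasAllMoments f μ :=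
  fun _ => MemLp.of_bound hf C (.of_forall hC)

theorem const [IsFiniteMeasure μ] (c : E) : HasAllMoments (fun _ : Ω => c) μ :=
  fun _ => memLp_const c

theorem mono {F : Type*} [NormedAddCommGroup F] {f : Ω → E} {g : Ω → F} (hg : HasAllMoments g μ)
    (hf : AEStronglyMeasurable f μ) (h : ∀ ω, ‖f ω‖ ≤ ‖g ω‖) : HasAllMoments f μ :=
  fun r => (hg r).mono hf (.of_forall h)

theorem norm {f : Ω → E} (hf : HasAllMoments f μ) : HasAllMoments (fun ω => ‖f ω‖) μ :=
  fun r => (hf r).norm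

theorem add {f g : Ω → E} (hf : HasAllMoments f μ) (hg : HasAllMoments g μ) :
    HasAllMoments (fun ω => f ω + g ω) μ :=
  fun r => (hf r).add (hg r)

theorem sub {f g : Ω → E} (hf : HasAllMoments f μ) (hg : HasAllMoments g μ) :
    HasAllMoments (fun ω => f ω - g ω) μ :=
  fun r => (hf r).sub (hg r)

theorem smul [NormedSpace ℝ E] {f : Ω → ℝ} {g : Ω → E} (hf : HasAllMoments f μ)
    (hg : HasAllMoments g μ) : HasAllMoments (fun ω => f ω • g ω) μ := by
  intro r
  have : ENNReal.HolderTriple ((2 * r : ℝ≥0) : ℝ≥0∞) ((2 * r : ℝ≥0) : ℝ≥0∞) r := by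
    constructor
    push_cast
    rw [ENNReal.mul_inv (by simp) (by simp), ← add_mul, ENNReal.inv_two_add_inv_two, one_mul]
  exact (hg (2 * r)).smul (hf (2 * r))

theorem mul {f g : Ω → ℝ} (hf : HasAllMoments f μ) (hg : HasAllMoments g μ) :
    HasAllMoments (fun ω => f ω * g ω) μ :=
  hf.smul hg

theorem const_mul [IsFiniteMeasure μ] {f : Ω → ℝ} (hf : HasAllMoments f μ) (c : ℝ) :
    HasAllMoments (fun ω => c * f ω) μ :=
  (const c).mul hf

theorem sq {f : Ω → ℝ} (hf : HasAllMoments f μ) : HasAllMoments (fun ω => f ω ^ 2) μ := by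
  simpa only [pow_two] using hf.mul hf

theorem norm_rpow [IsFiniteMeasure μ] {f : Ω → E} (hf : HasAllMoments f μ) {s : ℝ} (hs : 0 ≤ s) :
    HasAllMoments (fun ω => ‖f ω‖ ^ s) μ := by
  rcases hs.eq_or_lt with rfl | hs
  · simpa using const (1 : ℝ)
  intro r
  have h := (memLp_norm_rpow_iff (q := (s.toNNReal : ℝ≥0∞))
    (p := ((r * s.toNNReal : ℝ≥0) : ℝ≥0∞)) hf.aestronglyMeasurable (by simpa using hs)
    ENNReal.coe_ne_top).2 (hf _)
  rw [ENNReal.coe_mul, ENNReal.mul_div_cancel_right (by simpa using hs) ENNReal.coe_ne_top] at h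
  simpa [hs.le] using h

theorem rpow [IsFiniteMeasure μ] {f : Ω → ℝ} (hf : HasAllMoments f μ) (h₀ : ∀ ω, 0 ≤ f ω)
    {s : ℝ} (hs : 0 ≤ s) : HasAllMoments (fun ω => f ω ^ s) μ := by
  simpa only [Real.norm_of_nonneg (h₀ _)] using hf.norm_rpow hs

theorem inner [InnerProductSpace ℝ E] {f g : Ω → E} (hf : HasAllMoments f μ)
    (hg : HasAllMoments g μ) : HasAllMoments (fun ω => inner ℝ (f ω) (g ω)) μ :=
  (hf.norm.mul hg.norm).mono (hf.aestronglyMeasurable.inner hg.aestronglyMeasurable) fun ω => by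
    simpa using norm_inner_le_norm (𝕜 := ℝ) (f ω) (g ω)

theorem sup {f g : Ω → ℝ} (hf : HasAllMoments f μ) (hg : HasAllMoments g μ) :
    HasAllMoments (fun ω => f ω ⊔ g ω) μ :=
  fun r => (hf r).sup (hg r)

theorem integral_rpow_sub_one_mul_le [IsFiniteMeasure μ] {f g : Ω → ℝ} {q ε K : ℝ}
    (hf : HasAllMoments f μ) (hg : HasAllMoments g μ) (hf₀ : ∀ ω, 0 ≤ f ω) (hg₀ : ∀ ω, 0 ≤ g ω)
    (hq : 1 ≤ q) (hK : ∀ a b : ℝ, 0 ≤ a → 0 ≤ b → a ^ (q - 1) * b ≤ ε * a ^ q + K * b ^ q) :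
    ∫ ω, f ω ^ (q - 1) * g ω ∂μ ≤ ε * ∫ ω, f ω ^ q ∂μ + K * ∫ ω, g ω ^ q ∂μ := by
  have hq₀ : 0 ≤ q := by linarith
  have hfq := (hf.rpow hf₀ hq₀).const_mul ε
  have hgq := (hg.rpow hg₀ hq₀).const_mul K
  rw [← integral_const_mul, ← integral_const_mul, ← integral_add hfq.integrable hgq.integrable]
  exact integral_mono ((hf.rpow hf₀ (by linarith)).mul hg).integrable (hfq.add hgq).integrable
    fun ω => hK _ _ (hf₀ ω) (hg₀ ω)

end HasAllMoments

theorem integral_le_integral_of_add_le {f g w : Ω → ℝ} (hf : Integrable f μ) (hg : Integrable g μ)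
    (hw : Integrable w μ) (h : ∀ ω, f ω + w ω ≤ g ω) :
    ∫ ω, f ω ∂μ + ∫ ω, w ω ∂μ ≤ ∫ ω, g ω ∂μ := by
  rw [← integral_add hf hw]
  exact integral_mono (hf.add hw) hg h

end AllMoments

section Model

variable {Ω H : Type*} {mΩ : MeasurableSpace Ω} [NormedAddCommGroup H]

/-- The discrete model of the Poisson stochastic integral. -/
structure DiscretePoissonModel (μ : Measure Ω) (𝒢 : Filtration ℕ mΩ) (n : ℕ) (N : ℕ → Ω → ℕ)
    (lam : ℕ → ℝ≥0) (y : ℕ → Ω → H) : Prop where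
  lam_le : ∀ k < n, lam (k + 1) ≤ 1
  measurable : ∀ k < n, Measurable[𝒢 (k + 1)] (N (k + 1))
  map_eq : ∀ k < n, μ.map (N (k + 1)) = poissonMeasure (lam (k + 1))
  indep : ∀ k < n, Indep (MeasurableSpace.comap (N (k + 1)) inferInstance) (𝒢 k) μ
  stronglyMeasurable : ∀ k < n, StronglyMeasurable[𝒢 k] (y (k + 1))
  bounded : ∀ k < n, ∃ c : ℝ, ∀ ω, ‖y (k + 1) ω‖ ≤ c

/-- The predictable quadratic variation of the partial sums. -/
noncomputable def poissonVar (lam : ℕ → ℝ≥0) (y : ℕ → Ω → H) (k : ℕ) (ω : Ω) : ℝ :=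
  ∑ i ∈ Finset.Icc 1 k, (lam i : ℝ) * ‖y i ω‖ ^ 2

variable {N : ℕ → Ω → ℕ} {lam : ℕ → ℝ≥0} {y : ℕ → Ω → H}

@[simp]
theorem poissonVar_zero (ω : Ω) : poissonVar lam y 0 ω = 0 := by simp [poissonVar]

theorem poissonVar_succ (k : ℕ) (ω : Ω) : poissonVar lam y (k + 1) ω
    = poissonVar lam y k ω + (lam (k + 1) : ℝ) * ‖y (k + 1) ω‖ ^ 2 := by
  rw [poissonVar, Finset.sum_Icc_succ_top (by simp), poissonVar]

theorem poissonVar_nonneg (k : ℕ) (ω : Ω) : 0 ≤ poissonVar lam y k ω :=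
  Finset.sum_nonneg fun _ _ => by positivity

namespace DiscretePoissonModel

variable {μ : Measure Ω} {𝒢 : Filtration ℕ mΩ} {n : ℕ}

theorem stronglyMeasurable_poissonVar_succ (h : DiscretePoissonModel μ 𝒢 n N lam y) {k : ℕ}
    (hk : k < n) : StronglyMeasurable[𝒢 k] (poissonVar lam y (k + 1)) := by
  refine Finset.stronglyMeasurable_fun_sum _ fun i hi => ?_
  obtain ⟨hi₁, hi₂⟩ := Finset.mem_Icc.1 hi
  obtain ⟨j, rfl⟩ := Nat.exists_eq_add_of_le' hi₁
  exact (((h.stronglyMeasurable j (by omega)).mono (𝒢.mono (by omega))).norm.pow 2).const_mul _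

/-- Independence of an increment from the past. -/
theorem integral_mul_comp (h : DiscretePoissonModel μ 𝒢 n N lam y) {k : ℕ} (hk : k < n)
    {Z : Ω → ℝ} (hZ : StronglyMeasurable[𝒢 k] Z) (g : ℕ → ℝ) :
    ∫ ω, Z ω * g (N (k + 1) ω) ∂μ
      = (∫ ω, Z ω ∂μ) * ∫ m, g m ∂poissonMeasure (lam (k + 1)) := by
  have hN : Measurable (N (k + 1)) := (h.measurable k hk).mono (𝒢.le _) le_rfl
  have hg : Measurable g := measurable_from_nat
  have hi : IndepFun Z (fun ω => g (N (k + 1) ω)) μ := by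
    rw [IndepFun_iff_Indep]
    refine indep_of_indep_of_le_left (indep_of_indep_of_le_right (h.indep k hk).symm ?_) ?_
    · exact (hg.comp (comap_measurable (N (k + 1)))).comap_le
    · exact hZ.measurable.comap_le
  rw [← h.map_eq k hk, integral_map hN.aemeasurable hg.aestronglyMeasurable]
  exact hi.integral_mul_eq_mul_integral (hZ.mono (𝒢.le k)).aestronglyMeasurable
    (hg.comp hN).aestronglyMeasurable

theorem integral_mul_increment (h : DiscretePoissonModel μ 𝒢 n N lam y) {k : ℕ} (hk : k < n)
    {Z : Ω → ℝ} (hZ : StronglyMeasurable[𝒢 k] Z) :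
    ∫ ω, Z ω * ((N (k + 1) ω : ℝ) - lam (k + 1)) ∂μ = 0 := by
  rw [h.integral_mul_comp hk hZ (fun m => (m : ℝ) - lam (k + 1)),
    integral_natCast_sub_poissonMeasure (h.lam_le k hk), mul_zero]

theorem integral_mul_increment_sq (h : DiscretePoissonModel μ 𝒢 n N lam y) {k : ℕ} (hk : k < n)
    {Z : Ω → ℝ} (hZ : StronglyMeasurable[𝒢 k] Z) :
    ∫ ω, Z ω * ((N (k + 1) ω : ℝ) - lam (k + 1)) ^ 2 ∂μ = ∫ ω, (lam (k + 1) : ℝ) * Z ω ∂μ := by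
  rw [h.integral_mul_comp hk hZ (fun m => ((m : ℝ) - lam (k + 1)) ^ 2),
    integral_natCast_sub_sq_poissonMeasure (h.lam_le k hk), integral_const_mul, mul_comm]

theorem integral_norm_rpow_mul_abs_increment_rpow (h : DiscretePoissonModel μ 𝒢 n N lam y)
    {k : ℕ} (hk : k < n) (p : ℝ) :
    ∫ ω, ‖y (k + 1) ω‖ ^ p * |(N (k + 1) ω : ℝ) - lam (k + 1)| ^ p ∂μ
      = (∫ ω, ‖y (k + 1) ω‖ ^ p ∂μ) *
        ∫ m : ℕ, |(m : ℝ) - lam (k + 1)| ^ p ∂poissonMeasure (lam (k + 1)) :=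
  h.integral_mul_comp hk
    ((h.stronglyMeasurable k hk).norm.measurable.pow_const p).stronglyMeasurable
    (fun m => |(m : ℝ) - lam (k + 1)| ^ p)

theorem hasAllMoments_increment (h : DiscretePoissonModel μ 𝒢 n N lam y) {k : ℕ} (hk : k < n) :
    HasAllMoments (fun ω => (N (k + 1) ω : ℝ) - lam (k + 1)) μ := by
  intro r
  have hN : Measurable (N (k + 1)) := (h.measurable k hk).mono (𝒢.le _) le_rfl
  have hg : Measurable fun m : ℕ => (m : ℝ) - lam (k + 1) := measurable_from_nat
  rcases eq_or_ne r 0 with rfl | hr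
  · exact memLp_zero_iff_aestronglyMeasurable.2 (hg.comp hN).aestronglyMeasurable
  refine (memLp_map_measure_iff hg.aestronglyMeasurable hN.aemeasurable).1 ?_
  rw [h.map_eq k hk, ← integrable_norm_rpow_iff hg.aestronglyMeasurable (by simpa using hr)
    ENNReal.coe_ne_top]
  exact integrable_abs_natCast_sub_rpow_poissonMeasure (h.lam_le k hk) r.2

variable [IsProbabilityMeasure μ]

theorem hasAllMoments_integrand (h : DiscretePoissonModel μ 𝒢 n N lam y) {k : ℕ} (hk : k < n) :
    HasAllMoments (y (k + 1)) μ := by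
  obtain ⟨c, hc⟩ := h.bounded k hk
  exact .of_bound ((h.stronglyMeasurable k hk).mono (𝒢.le k)).aestronglyMeasurable c hc

theorem hasAllMoments_poissonVar (h : DiscretePoissonModel μ 𝒢 n N lam y) {k : ℕ}
    (hk : k ≤ n) : HasAllMoments (poissonVar lam y k) μ := by
  induction k with
  | zero => simpa only [funext poissonVar_zero] using HasAllMoments.const (0 : ℝ)
  | succ k ih =>
    simp only [funext (poissonVar_succ k)]
    exact (ih (by omega)).add ((h.hasAllMoments_integrand hk).norm.sq.const_mul _)

end DiscretePoissonModel

variable [InnerProductSpace ℝ H]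

/-- The partial sums of the discrete Poisson stochastic integral. -/
noncomputable def poissonSum (N : ℕ → Ω → ℕ) (lam : ℕ → ℝ≥0) (y : ℕ → Ω → H) (k : ℕ) (ω : Ω) : H :=
  ∑ i ∈ Finset.Icc 1 k, ((N i ω : ℝ) - lam i) • y i ω

/-- The running maximum of the norms of the partial sums. -/
noncomputable def poissonMax (N : ℕ → Ω → ℕ) (lam : ℕ → ℝ≥0) (y : ℕ → Ω → H) (k : ℕ) (ω : Ω) : ℝ :=
  partialSups (fun m => ‖poissonSum N lam y m ω‖) k

@[simp]
theorem poissonSum_zero (ω : Ω) : poissonSum N lam y 0 ω = 0 := by simp [poissonSum]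

theorem poissonSum_succ (k : ℕ) (ω : Ω) : poissonSum N lam y (k + 1) ω
    = poissonSum N lam y k ω + ((N (k + 1) ω : ℝ) - lam (k + 1)) • y (k + 1) ω := by
  rw [poissonSum, Finset.sum_Icc_succ_top (by simp), poissonSum]

@[simp]
theorem poissonMax_zero (ω : Ω) : poissonMax N lam y 0 ω = 0 := by simp [poissonMax]

theorem poissonMax_succ (k : ℕ) (ω : Ω) : poissonMax N lam y (k + 1) ω
    = poissonMax N lam y k ω ⊔ ‖poissonSum N lam y (k + 1) ω‖ :=
  partialSups_add_one _ _

theorem norm_poissonSum_le_poissonMax {k n : ℕ} (hkn : k ≤ n) (ω : Ω) :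
    ‖poissonSum N lam y k ω‖ ≤ poissonMax N lam y n ω :=
  le_partialSups_of_le (fun m => ‖poissonSum N lam y m ω‖) hkn

theorem poissonMax_nonneg (k : ℕ) (ω : Ω) : 0 ≤ poissonMax N lam y k ω :=
  (norm_nonneg (poissonSum N lam y k ω)).trans (norm_poissonSum_le_poissonMax le_rfl ω)

theorem sup'_norm_poissonSum {n : ℕ} (hn : (Finset.Icc 1 n).Nonempty) (ω : Ω) :
    ((Finset.Icc 1 n).sup' hn fun m => ‖poissonSum N lam y m ω‖) = poissonMax N lam y n ω := by
  apply le_antisymm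
  · exact Finset.sup'_le _ _ fun m hm => norm_poissonSum_le_poissonMax (Finset.mem_Icc.1 hm).2 ω
  · refine partialSups_le _ _ _ fun m hm => ?_
    rcases m.eq_zero_or_pos with rfl | hm'
    · obtain ⟨j, hj⟩ := hn
      simpa using Finset.le_sup'_of_le (fun m => ‖poissonSum N lam y m ω‖) hj (norm_nonneg _)
    · exact Finset.le_sup' (fun m => ‖poissonSum N lam y m ω‖) (Finset.mem_Icc.2 ⟨hm', hm⟩)

namespace DiscretePoissonModel

variable {μ : Measure Ω} {𝒢 : Filtration ℕ mΩ} {n : ℕ}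

theorem stronglyMeasurable_poissonSum (h : DiscretePoissonModel μ 𝒢 n N lam y) {k : ℕ}
    (hk : k ≤ n) : StronglyMeasurable[𝒢 k] (poissonSum N lam y k) := by
  induction k with
  | zero =>
    simp only [funext poissonSum_zero]
    exact stronglyMeasurable_const
  | succ k ih =>
    simp only [funext (poissonSum_succ k)]
    refine ((ih (by omega)).mono (𝒢.mono k.le_succ)).add (StronglyMeasurable.smul ?_
      ((h.stronglyMeasurable k hk).mono (𝒢.mono k.le_succ)))
    exact ((measurable_from_nat (f := fun m : ℕ => (m : ℝ) - lam (k + 1))).comp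
      (h.measurable k hk)).stronglyMeasurable

theorem stronglyMeasurable_poissonMax (h : DiscretePoissonModel μ 𝒢 n N lam y) {k : ℕ}
    (hk : k ≤ n) : StronglyMeasurable[𝒢 k] (poissonMax N lam y k) := by
  induction k with
  | zero =>
    simp only [funext poissonMax_zero]
    exact stronglyMeasurable_const
  | succ k ih =>
    simp only [funext (poissonMax_succ k)]
    exact continuous_sup.comp_stronglyMeasurable (((ih (by omega)).mono (𝒢.mono k.le_succ)).prodMk
      (h.stronglyMeasurable_poissonSum hk).norm)

variable [IsProbabilityMeasure μ]

theorem hasAllMoments_poissonSum (h : DiscretePoissonModel μ 𝒢 n N lam y) {k : ℕ}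
    (hk : k ≤ n) : HasAllMoments (poissonSum N lam y k) μ := by
  induction k with
  | zero => simpa only [funext poissonSum_zero] using HasAllMoments.const (0 : H)
  | succ k ih =>
    simp only [funext (poissonSum_succ k)]
    exact (ih (by omega)).add ((h.hasAllMoments_increment hk).smul (h.hasAllMoments_integrand hk))

theorem hasAllMoments_poissonMax (h : DiscretePoissonModel μ 𝒢 n N lam y) {k : ℕ}
    (hk : k ≤ n) : HasAllMoments (poissonMax N lam y k) μ := by
  induction k with
  | zero => simpa only [funext poissonMax_zero] using HasAllMoments.const (0 : ℝ)
  | succ k ih =>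
    simp only [funext (poissonMax_succ k)]
    exact (ih (by omega)).sup (h.hasAllMoments_poissonSum hk).norm

/-- Doob's maximal inequality, before an application of Hölder's inequality. -/
theorem mul_integral_poissonMax_rpow_le (h : DiscretePoissonModel μ 𝒢 n N lam y) {p : ℝ}
    (hp : 1 ≤ p) :
    (p - 1) * ∫ ω, poissonMax N lam y n ω ^ p ∂μ
      ≤ p * ∫ ω, poissonMax N lam y n ω ^ (p - 1) * ‖poissonSum N lam y n ω‖ ∂μ := by
  have hp₁ : 0 ≤ p - 1 := by linarith
  have hS {s : ℝ} (hs : 0 ≤ s) {k : ℕ} (hk : k ≤ n) :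
      HasAllMoments (fun ω => poissonMax N lam y k ω ^ s) μ :=
    (h.hasAllMoments_poissonMax hk).rpow (poissonMax_nonneg k) hs
  have hSX {k : ℕ} (hk : k ≤ n) : HasAllMoments
      (fun ω => p * (poissonMax N lam y k ω ^ (p - 1) * ‖poissonSum N lam y k ω‖)) μ :=
    ((hS hp₁ hk).mul (h.hasAllMoments_poissonSum hk).norm).const_mul p
  have hSp {k : ℕ} (hk : k ≤ n) :
      HasAllMoments (fun ω => (p - 1) * poissonMax N lam y k ω ^ p) μ :=
    (hS (by linarith) hk).const_mul _
  have key : ∀ k ≤ n, 0 ≤ ∫ ω, (p * (poissonMax N lam y k ω ^ (p - 1) * ‖poissonSum N lam y k ω‖)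
      - (p - 1) * poissonMax N lam y k ω ^ p) ∂μ := by
    intro k
    induction k with
    | zero => simp [Real.zero_rpow (by linarith : p ≠ 0)]
    | succ k ih =>
      intro hk
      have hk' : k ≤ n := by omega
      have hM := h.stronglyMeasurable_poissonSum hk'
      have hMm := h.hasAllMoments_poissonSum hk'
      have hy := h.stronglyMeasurable k hk
      have hym := h.hasAllMoments_integrand hk
      set u : Ω → ℝ := fun ω =>
        ‖poissonSum N lam y k ω‖⁻¹ * inner ℝ (poissonSum N lam y k ω) (y (k + 1) ω) with hu
      have hum : StronglyMeasurable[𝒢 k] u := hM.norm.inv₀.mul (hM.inner hy)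
      have hum' : HasAllMoments u μ := by
        refine hym.mono (hum.mono (𝒢.le k)).aestronglyMeasurable fun ω => ?_
        rw [hu, norm_mul, norm_inv, norm_norm]
        refine inv_mul_le_of_le_mul₀ (norm_nonneg _) (norm_nonneg _) ?_
        exact norm_inner_le_norm _ _
      have hZ : StronglyMeasurable[𝒢 k] fun ω => p * (poissonMax N lam y k ω ^ (p - 1) * u ω) := by
        have := (h.stronglyMeasurable_poissonMax hk').measurable.pow_const (p - 1)
        exact (this.stronglyMeasurable.mul hum).const_mul p
      have hZm : HasAllMoments (fun ω => p * (poissonMax N lam y k ω ^ (p - 1) * u ω)) μ :=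
        ((hS hp₁ hk').mul hum').const_mul p
      have step := integral_le_integral_of_add_le ((hSX hk').sub (hSp hk')).integrable
        ((hSX hk).sub (hSp hk)).integrable (hZm.mul (h.hasAllMoments_increment hk)).integrable
        fun ω => ?_
      · rw [h.integral_mul_increment hk hZ, add_zero] at step
        exact (ih hk').trans step
      · rw [poissonMax_succ]
        refine le_trans ?_ (doob_step (poissonMax_nonneg k ω) (norm_nonneg _) hp)
        have hnorm := norm_add_inv_norm_mul_inner_le (poissonSum N lam y k ω)
          (((N (k + 1) ω : ℝ) - lam (k + 1)) • y (k + 1) ω)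
        rw [← poissonSum_succ, inner_smul_right] at hnorm
        have := mul_le_mul_of_nonneg_left hnorm (mul_nonneg (by linarith : 0 ≤ p)
          (Real.rpow_nonneg (poissonMax_nonneg (N := N) (lam := lam) (y := y) k ω) (p - 1)))
        simp only [hu]
        linarith
  have := key n le_rfl
  rw [integral_sub (hSX le_rfl).integrable (hSp le_rfl).integrable, integral_const_mul,
    integral_const_mul] at this
  linarith

theorem norm_sq_poissonSum_succ (k : ℕ) (ω : Ω) :
    ‖poissonSum N lam y (k + 1) ω‖ ^ 2 - ‖poissonSum N lam y k ω‖ ^ 2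
      = 2 * inner ℝ (poissonSum N lam y k ω) (y (k + 1) ω) * ((N (k + 1) ω : ℝ) - lam (k + 1))
        + ‖y (k + 1) ω‖ ^ 2 * ((N (k + 1) ω : ℝ) - lam (k + 1)) ^ 2 := by
  rw [poissonSum_succ, norm_add_sq_real, inner_smul_right, norm_smul, mul_pow, Real.norm_eq_abs,
    sq_abs]
  ring

/-- A dual form of Doob's inequality for the predictable quadratic variation, before an
application of Hölder's inequality. -/
theorem integral_poissonVar_rpow_le (h : DiscretePoissonModel μ 𝒢 n N lam y) {q : ℝ}
    (hq : 1 ≤ q) :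
    ∫ ω, poissonVar lam y n ω ^ q ∂μ
      ≤ q * ∫ ω, poissonVar lam y n ω ^ (q - 1) * ‖poissonSum N lam y n ω‖ ^ 2 ∂μ := by
  have hq₁ : 0 ≤ q - 1 := by linarith
  have hA {s : ℝ} (hs : 0 ≤ s) {k : ℕ} (hk : k ≤ n) :
      HasAllMoments (fun ω => poissonVar lam y k ω ^ s) μ :=
    (h.hasAllMoments_poissonVar hk).rpow (poissonVar_nonneg k) hs
  have hAX {k : ℕ} (hk : k ≤ n) : HasAllMoments
      (fun ω => q * (poissonVar lam y k ω ^ (q - 1) * ‖poissonSum N lam y k ω‖ ^ 2)) μ :=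
    ((hA hq₁ hk).mul (h.hasAllMoments_poissonSum hk).norm.sq).const_mul q
  have hAq {k : ℕ} (hk : k ≤ n) : HasAllMoments (fun ω => poissonVar lam y k ω ^ q) μ :=
    hA (by linarith) hk
  have key : ∀ k ≤ n, 0 ≤ ∫ ω, (q * (poissonVar lam y k ω ^ (q - 1) *
      ‖poissonSum N lam y k ω‖ ^ 2) - poissonVar lam y k ω ^ q) ∂μ := by
    intro k
    induction k with
    | zero => simp [Real.zero_rpow (by linarith : q ≠ 0)]
    | succ k ih =>
      intro hk
      have hk' : k ≤ n := by omega
      have hM := h.stronglyMeasurable_poissonSum hk'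
      have hMm := h.hasAllMoments_poissonSum hk'
      have hy := h.stronglyMeasurable k hk
      have hym := h.hasAllMoments_integrand hk
      have hξ := h.hasAllMoments_increment hk
      have hV : StronglyMeasurable[𝒢 k] fun ω => poissonVar lam y (k + 1) ω ^ (q - 1) :=
        ((h.stronglyMeasurable_poissonVar_succ hk).measurable.pow_const (q - 1)).stronglyMeasurable
      set Z₁ : Ω → ℝ := fun ω => poissonVar lam y (k + 1) ω ^ (q - 1) *
        (2 * inner ℝ (poissonSum N lam y k ω) (y (k + 1) ω)) with hZ₁
      set Z₂ : Ω → ℝ := fun ω => poissonVar lam y (k + 1) ω ^ (q - 1) * ‖y (k + 1) ω‖ ^ 2 with hZ₂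
      have hZ₁m : StronglyMeasurable[𝒢 k] Z₁ := hV.mul ((hM.inner hy).const_mul 2)
      have hZ₂m : StronglyMeasurable[𝒢 k] Z₂ := hV.mul (hy.norm.pow 2)
      have hi₁ := ((hA hq₁ hk).mul ((hMm.inner hym).const_mul 2)).mul hξ
      have hZ₂i : HasAllMoments Z₂ μ := (hA hq₁ hk).mul hym.norm.sq
      have hi₂ := hZ₂i.mul hξ.sq
      have hi₃ := hZ₂i.const_mul (lam (k + 1) : ℝ)
      have step := integral_le_integral_of_add_le ((hAX hk').sub (hAq hk')).integrable
        ((hAX hk).sub (hAq hk)).integrable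
        (((hi₁.add hi₂).sub hi₃).const_mul q).integrable fun ω => ?_
      · rw [integral_const_mul, integral_sub (hi₁.add hi₂).integrable hi₃.integrable,
          integral_add hi₁.integrable hi₂.integrable, h.integral_mul_increment hk hZ₁m,
          h.integral_mul_increment_sq hk hZ₂m, zero_add, sub_self, mul_zero, add_zero] at step
        exact (ih hk').trans step
      · have := rpow_mul_sub_rpow_step (x' := ‖poissonSum N lam y (k + 1) ω‖ ^ 2)
          (poissonVar_nonneg (lam := lam) (y := y) k ω)
          (mul_nonneg (lam (k + 1)).coe_nonneg (sq_nonneg ‖y (k + 1) ω‖))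
          (sq_nonneg ‖poissonSum N lam y k ω‖) hq
        rw [norm_sq_poissonSum_succ, ← poissonVar_succ] at this
        refine le_trans (le_of_eq ?_) this
        simp only [hZ₂]
        ring
  have := key n le_rfl
  rw [integral_sub (hAX le_rfl).integrable (hAq le_rfl).integrable, integral_const_mul] at this
  linarith

theorem mul_sum_integral_norm_rpow_le (h : DiscretePoissonModel μ 𝒢 n N lam y) {p : ℝ}
    (hp : 2 ≤ p) :
    2 * (1 / 2) ^ p * (Real.exp (-1) * (1 / 2) ^ p) *
        ∑ i ∈ Finset.Icc 1 n, (lam i : ℝ) * ∫ ω, ‖y i ω‖ ^ p ∂μ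
      ≤ ∫ ω, ‖poissonSum N lam y n ω‖ ^ p ∂μ := by
  have hp₀ : 0 ≤ p := by linarith
  have hp₂ : 0 ≤ p - 2 := by linarith
  suffices ∀ k ≤ n, 2 * (1 / 2) ^ p * (Real.exp (-1) * (1 / 2) ^ p) *
      ∑ i ∈ Finset.Icc 1 k, (lam i : ℝ) * ∫ ω, ‖y i ω‖ ^ p ∂μ
      ≤ ∫ ω, ‖poissonSum N lam y k ω‖ ^ p ∂μ from this n le_rfl
  intro k
  induction k with
  | zero => simp [Real.zero_rpow (by linarith : p ≠ 0)]
  | succ k ih =>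
    intro hk
    have hk' : k ≤ n := by omega
    have hM := h.stronglyMeasurable_poissonSum hk'
    have hMm := h.hasAllMoments_poissonSum hk'
    have hy := h.stronglyMeasurable k hk
    have hym := h.hasAllMoments_integrand hk
    have hξ := h.hasAllMoments_increment hk
    have hZ : StronglyMeasurable[𝒢 k] fun ω => ‖poissonSum N lam y k ω‖ ^ (p - 2) *
        inner ℝ (poissonSum N lam y k ω) (y (k + 1) ω) :=
      (hM.norm.measurable.pow_const (p - 2)).stronglyMeasurable.mul (hM.inner hy)
    have hi₁ := (((hMm.norm_rpow hp₂).mul (hMm.inner hym)).mul hξ).const_mul p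
    have hi₂ := ((hym.norm_rpow hp₀).mul (hξ.norm_rpow hp₀)).const_mul (2 * (1 / 2) ^ p)
    have step := integral_le_integral_of_add_le (hMm.norm_rpow hp₀).integrable
      ((h.hasAllMoments_poissonSum hk).norm_rpow hp₀).integrable (hi₁.add hi₂).integrable
      fun ω => ?_
    · simp only [Real.norm_eq_abs] at hi₂ step
      rw [integral_add hi₁.integrable hi₂.integrable, integral_const_mul, integral_const_mul,
        h.integral_mul_increment hk hZ, h.integral_norm_rpow_mul_abs_increment_rpow hk,
        mul_zero, zero_add] at step
      refine le_trans ?_ step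
      rw [Finset.sum_Icc_succ_top (by simp), mul_add]
      refine add_le_add (ih hk') ?_
      have hlow := mul_le_integral_abs_natCast_sub_rpow hp₀ (h.lam_le k hk)
      have hy₀ : 0 ≤ ∫ ω, ‖y (k + 1) ω‖ ^ p ∂μ := integral_nonneg fun ω => by positivity
      have := mul_le_mul_of_nonneg_left hlow
        (mul_nonneg (by positivity : (0 : ℝ) ≤ 2 * (1 / 2) ^ p) hy₀)
      linarith
    · have := norm_rpow_add_inner_add_le (poissonSum N lam y k ω)
        (((N (k + 1) ω : ℝ) - lam (k + 1)) • y (k + 1) ω) hp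
      rw [← poissonSum_succ, inner_smul_right, norm_smul,
        Real.mul_rpow (norm_nonneg _) (norm_nonneg _)] at this
      linarith

theorem integral_norm_poissonSum_rpow_le (h : DiscretePoissonModel μ 𝒢 n N lam y) {p K : ℝ}
    (hp : 2 ≤ p) (hK : ∀ l : ℝ≥0, l ≤ 1 →
      ∫ m : ℕ, |(m : ℝ) - l| ^ p ∂poissonMeasure l ≤ K * l) :
    ∫ ω, ‖poissonSum N lam y n ω‖ ^ p ∂μ
      ≤ (p / 2 + p * (p - 1) * 2 ^ (p - 2)) *
        (∫ ω, poissonMax N lam y n ω ^ (p - 2) * poissonVar lam y n ω ∂μ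
          + K * ∑ i ∈ Finset.Icc 1 n, (lam i : ℝ) * ∫ ω, ‖y i ω‖ ^ p ∂μ) := by
  have hp₀ : 0 ≤ p := by linarith
  have hp₂ : 0 ≤ p - 2 := by linarith
  set C : ℝ := p / 2 + p * (p - 1) * 2 ^ (p - 2) with hC
  have hC₀ : 0 ≤ C := by
    have : 0 ≤ p - 1 := by linarith
    positivity
  have hS := (h.hasAllMoments_poissonMax le_rfl).rpow (poissonMax_nonneg n) hp₂
  suffices ∀ k ≤ n, ∫ ω, ‖poissonSum N lam y k ω‖ ^ p ∂μ
      ≤ C * (∫ ω, poissonMax N lam y n ω ^ (p - 2) * poissonVar lam y k ω ∂μ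
        + K * ∑ i ∈ Finset.Icc 1 k, (lam i : ℝ) * ∫ ω, ‖y i ω‖ ^ p ∂μ) from this n le_rfl
  intro k
  induction k with
  | zero => simp [Real.zero_rpow (by linarith : p ≠ 0)]
  | succ k ih =>
    intro hk
    have hk' : k ≤ n := by omega
    have hM := h.stronglyMeasurable_poissonSum hk'
    have hMm := h.hasAllMoments_poissonSum hk'
    have hy := h.stronglyMeasurable k hk
    have hym := h.hasAllMoments_integrand hk
    have hξ := h.hasAllMoments_increment hk
    have hMp : StronglyMeasurable[𝒢 k] fun ω => ‖poissonSum N lam y k ω‖ ^ (p - 2) :=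
      (hM.norm.measurable.pow_const (p - 2)).stronglyMeasurable
    have hZ₁ : StronglyMeasurable[𝒢 k] fun ω => ‖poissonSum N lam y k ω‖ ^ (p - 2) *
        inner ℝ (poissonSum N lam y k ω) (y (k + 1) ω) := hMp.mul (hM.inner hy)
    have hZ₂ : StronglyMeasurable[𝒢 k] fun ω => ‖poissonSum N lam y k ω‖ ^ (p - 2) *
        ‖y (k + 1) ω‖ ^ 2 := hMp.mul (hy.norm.pow 2)
    have hi₁ := (((hMm.norm_rpow hp₂).mul (hMm.inner hym)).mul hξ).const_mul p
    have hZ₂m := (hMm.norm_rpow hp₂).mul hym.norm.sq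
    have hi₂ := hZ₂m.mul hξ.sq
    have hi₃ := (hym.norm_rpow hp₀).mul (hξ.norm_rpow hp₀)
    have hw := hi₁.add ((hi₂.add hi₃).const_mul C)
    have step : ∫ ω, ‖poissonSum N lam y (k + 1) ω‖ ^ p ∂μ ≤ _ :=
      integral_mono ((h.hasAllMoments_poissonSum hk).norm_rpow hp₀).integrable
      ((hMm.norm_rpow hp₀).add hw).integrable fun ω => ?_
    · simp only [Real.norm_eq_abs] at hi₃ hw step
      rw [integral_add (hMm.norm_rpow hp₀).integrable hw.integrable,
        integral_add hi₁.integrable ((hi₂.add hi₃).const_mul C).integrable,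
        integral_const_mul, integral_const_mul, integral_add hi₂.integrable hi₃.integrable,
        h.integral_mul_increment hk hZ₁, h.integral_mul_increment_sq hk hZ₂,
        h.integral_norm_rpow_mul_abs_increment_rpow hk, mul_zero, zero_add] at step
      have hVar : ∫ ω, poissonMax N lam y n ω ^ (p - 2) * poissonVar lam y (k + 1) ω ∂μ
          = ∫ ω, poissonMax N lam y n ω ^ (p - 2) * poissonVar lam y k ω ∂μ
            + ∫ ω, poissonMax N lam y n ω ^ (p - 2) *
              ((lam (k + 1) : ℝ) * ‖y (k + 1) ω‖ ^ 2) ∂μ := by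
        rw [← integral_add (hS.mul (h.hasAllMoments_poissonVar hk')).integrable
          (hS.mul (hym.norm.sq.const_mul _)).integrable]
        simp only [poissonVar_succ, mul_add]
      have hmax : ∫ ω, (lam (k + 1) : ℝ) * (‖poissonSum N lam y k ω‖ ^ (p - 2) *
          ‖y (k + 1) ω‖ ^ 2) ∂μ ≤ ∫ ω, poissonMax N lam y n ω ^ (p - 2) *
              ((lam (k + 1) : ℝ) * ‖y (k + 1) ω‖ ^ 2) ∂μ := by
        refine integral_mono (hZ₂m.const_mul _).integrable
          (hS.mul (hym.norm.sq.const_mul _)).integrable fun ω => ?_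
        have : ‖poissonSum N lam y k ω‖ ^ (p - 2) ≤ poissonMax N lam y n ω ^ (p - 2) :=
          Real.rpow_le_rpow (norm_nonneg _) (norm_poissonSum_le_poissonMax hk' ω) hp₂
        have := mul_le_mul_of_nonneg_right this
          (mul_nonneg (lam (k + 1)).coe_nonneg (sq_nonneg ‖y (k + 1) ω‖))
        linarith
      have hy₀ : 0 ≤ ∫ ω, ‖y (k + 1) ω‖ ^ p ∂μ := integral_nonneg fun ω => by positivity
      have hmom := mul_le_mul_of_nonneg_left (hK _ (h.lam_le k hk)) hy₀
      refine step.trans ?_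
      rw [Finset.sum_Icc_succ_top (by simp), hVar]
      have := mul_le_mul_of_nonneg_left (add_le_add hmax hmom) hC₀
      have := ih hk'
      linarith
    · have := norm_add_rpow_le (poissonSum N lam y k ω)
        (((N (k + 1) ω : ℝ) - lam (k + 1)) • y (k + 1) ω) hp
      rw [← poissonSum_succ, inner_smul_right, norm_smul,
        Real.mul_rpow (norm_nonneg _) (norm_nonneg _), mul_pow, Real.norm_eq_abs, sq_abs,
        ← hC] at this
      simp only [Real.norm_eq_abs]
      linarith

theorem integral_poissonVar_rpow_half_le (h : DiscretePoissonModel μ 𝒢 n N lam y) {p K : ℝ}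
    (hp : 2 ≤ p) (hK : ∀ a b : ℝ, 0 ≤ a → 0 ≤ b →
      a ^ (p / 2 - 1) * b ≤ 1 / p * a ^ (p / 2) + K * b ^ (p / 2)) :
    ∫ ω, poissonVar lam y n ω ^ (p / 2) ∂μ ≤ p * K * ∫ ω, ‖poissonSum N lam y n ω‖ ^ p ∂μ := by
  have hq : 1 ≤ p / 2 := by linarith
  have young := (h.hasAllMoments_poissonVar le_rfl).integral_rpow_sub_one_mul_le
    (h.hasAllMoments_poissonSum le_rfl).norm.sq (poissonVar_nonneg n) (fun _ => sq_nonneg _) hq hK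
  simp only [sq_rpow_half (norm_nonneg _)] at young
  have := (h.integral_poissonVar_rpow_le hq).trans
    (mul_le_mul_of_nonneg_left young (by linarith : 0 ≤ p / 2))
  have hpp : p * (1 / p) = 1 := mul_one_div_cancel (by linarith)
  linear_combination 2 * this + (∫ ω, poissonVar lam y n ω ^ (p / 2) ∂μ) * hpp

theorem integral_poissonMax_rpow_le (h : DiscretePoissonModel μ 𝒢 n N lam y) {p K : ℝ}
    (hp : 1 < p) (hK : ∀ a b : ℝ, 0 ≤ a → 0 ≤ b →
      a ^ (p - 1) * b ≤ (p - 1) / (2 * p) * a ^ p + K * b ^ p) :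
    ∫ ω, poissonMax N lam y n ω ^ p ∂μ
      ≤ 2 * p * K / (p - 1) * ∫ ω, ‖poissonSum N lam y n ω‖ ^ p ∂μ := by
  have young := (h.hasAllMoments_poissonMax le_rfl).integral_rpow_sub_one_mul_le
    (h.hasAllMoments_poissonSum le_rfl).norm (poissonMax_nonneg n) (fun _ => norm_nonneg _) hp.le hK
  have := (h.mul_integral_poissonMax_rpow_le hp.le).trans
    (mul_le_mul_of_nonneg_left young (by linarith : 0 ≤ p))
  rw [div_mul_eq_mul_div, le_div_iff₀ (by linarith)]
  have hpp : p * ((p - 1) / (2 * p)) = (p - 1) / 2 := by field_simp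
  linear_combination 2 * this + 2 * (∫ ω, poissonMax N lam y n ω ^ p ∂μ) * hpp

theorem integral_poissonMax_rpow_mul_poissonVar_le (h : DiscretePoissonModel μ 𝒢 n N lam y)
    {p ε K : ℝ} (hp : 2 ≤ p) (hK : ∀ a b : ℝ, 0 ≤ a → 0 ≤ b →
      a ^ (p / 2 - 1) * b ≤ ε * a ^ (p / 2) + K * b ^ (p / 2)) :
    ∫ ω, poissonMax N lam y n ω ^ (p - 2) * poissonVar lam y n ω ∂μ
      ≤ ε * ∫ ω, poissonMax N lam y n ω ^ p ∂μ
        + K * ∫ ω, poissonVar lam y n ω ^ (p / 2) ∂μ := by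
  have young := (h.hasAllMoments_poissonMax le_rfl).sq.integral_rpow_sub_one_mul_le
    (h.hasAllMoments_poissonVar le_rfl) (fun _ => sq_nonneg _) (poissonVar_nonneg n)
    (by linarith : 1 ≤ p / 2) hK
  simpa only [sq_rpow_half (poissonMax_nonneg _ _),
    sq_rpow_half_sub_one (poissonMax_nonneg _ _)] using young

theorem integral_norm_poissonSum_rpow_le_integral_poissonMax
    (h : DiscretePoissonModel μ 𝒢 n N lam y) {p : ℝ} (hp : 0 ≤ p) :
    ∫ ω, ‖poissonSum N lam y n ω‖ ^ p ∂μ ≤ ∫ ω, poissonMax N lam y n ω ^ p ∂μ :=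
  integral_mono ((h.hasAllMoments_poissonSum le_rfl).norm_rpow hp).integrable
    ((h.hasAllMoments_poissonMax le_rfl).rpow (poissonMax_nonneg n) hp).integrable fun ω =>
      Real.rpow_le_rpow (norm_nonneg _) (norm_poissonSum_le_poissonMax le_rfl ω) hp

end DiscretePoissonModel

end Model

/-- The Itô isomorphism for `p`-th powers. -/
theorem exists_integral_poissonMax_rpow_equiv {p : ℝ} (hp : 2 ≤ p) :
    ∃ D : ℝ, 0 < D ∧ ∀ {Ω H : Type*} {mΩ : MeasurableSpace Ω} [NormedAddCommGroup H]
      [InnerProductSpace ℝ H] {μ : Measure Ω} [IsProbabilityMeasure μ] {𝒢 : Filtration ℕ mΩ}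
      {n : ℕ} {N : ℕ → Ω → ℕ} {lam : ℕ → ℝ≥0} {y : ℕ → Ω → H},
      DiscretePoissonModel μ 𝒢 n N lam y →
      max (∫ ω, poissonVar lam y n ω ^ (p / 2) ∂μ)
          (∑ i ∈ Finset.Icc 1 n, (lam i : ℝ) * ∫ ω, ‖y i ω‖ ^ p ∂μ)
        ≤ D * ∫ ω, poissonMax N lam y n ω ^ p ∂μ ∧
      ∫ ω, poissonMax N lam y n ω ^ p ∂μ
        ≤ D * max (∫ ω, poissonVar lam y n ω ^ (p / 2) ∂μ)
          (∑ i ∈ Finset.Icc 1 n, (lam i : ℝ) * ∫ ω, ‖y i ω‖ ^ p ∂μ) := by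
  have hp₁ : 0 < p - 1 := by linarith
  have hp₀ : 0 < p := by linarith
  have hq : 1 ≤ p / 2 := by linarith
  obtain ⟨K, hK₀, hK⟩ := exists_integral_abs_natCast_sub_rpow_le hp
  obtain ⟨K₁, hK₁₀, hK₁⟩ := exists_rpow_sub_one_mul_le (q := p) (ε := (p - 1) / (2 * p))
    (by linarith) (by positivity)
  obtain ⟨K₂, hK₂₀, hK₂⟩ := exists_rpow_sub_one_mul_le (ε := 1 / p) hq (by positivity)
  set D₁ : ℝ := 2 * p * K₁ / (p - 1) with hD₁
  set D₂ : ℝ := D₁ * (p / 2 + p * (p - 1) * 2 ^ (p - 2)) with hD₂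
  have hD₂₀ : 0 < D₂ := by positivity
  obtain ⟨K₃, hK₃₀, hK₃⟩ := exists_rpow_sub_one_mul_le (ε := 1 / (2 * D₂)) hq (by positivity)
  set D₃ : ℝ := 2 * (1 / 2) ^ p * (Real.exp (-1) * (1 / 2) ^ p) with hD₃
  have hD₃₀ : 0 < D₃ := by positivity
  refine ⟨p * K₂ + D₃⁻¹ + 2 * D₂ * (K₃ + K), by positivity, ?_⟩
  intro Ω H mΩ _ _ μ _ 𝒢 n N lam y h
  have hB := h.mul_sum_integral_norm_rpow_le hp
  have hX := h.integral_norm_poissonSum_rpow_le hp hK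
  have hT := h.integral_poissonMax_rpow_le (by linarith) hK₁
  have hV := h.integral_poissonVar_rpow_half_le hp hK₂
  have hSA := h.integral_poissonMax_rpow_mul_poissonVar_le hp hK₃
  have hXT := h.integral_norm_poissonSum_rpow_le_integral_poissonMax hp₀.le
  have hX₀ : 0 ≤ ∫ ω, ‖poissonSum N lam y n ω‖ ^ p ∂μ := integral_nonneg fun ω => by positivity
  rw [← hD₃] at hB
  rw [← hD₁] at hT
  generalize ∫ ω, poissonMax N lam y n ω ^ p ∂μ = T at *
  generalize ∫ ω, ‖poissonSum N lam y n ω‖ ^ p ∂μ = X at *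
  generalize ∫ ω, poissonVar lam y n ω ^ (p / 2) ∂μ = V at *
  generalize ∑ i ∈ Finset.Icc 1 n, (lam i : ℝ) * ∫ ω, ‖y i ω‖ ^ p ∂μ = B at *
  generalize ∫ ω, poissonMax N lam y n ω ^ (p - 2) * poissonVar lam y n ω ∂μ = Y at *
  have hT₀ : 0 ≤ T := hX₀.trans hXT
  have hD₁₀ : 0 < D₁ := by positivity
  have hD (D : ℝ) (hD₀ : 0 ≤ D) (hD : D ≤ p * K₂ + D₃⁻¹ + 2 * D₂ * (K₃ + K)) : D * X ≤
      (p * K₂ + D₃⁻¹ + 2 * D₂ * (K₃ + K)) * T := by gcongr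
  constructor
  · refine max_le (hV.trans (hD _ (by positivity) ?_)) (le_trans ?_ (hD D₃⁻¹ (by positivity) ?_))
    · linarith [(by positivity : 0 ≤ D₃⁻¹ + 2 * D₂ * (K₃ + K))]
    · rwa [le_inv_mul_iff₀ hD₃₀]
    · linarith [(by positivity : 0 ≤ p * K₂ + 2 * D₂ * (K₃ + K))]
  · have hTD : T ≤ 2 * D₂ * (K₃ * V + K * B) := by
      have h₁ := hT.trans (mul_le_mul_of_nonneg_left hX hD₁₀.le)
      have h₂ := mul_le_mul_of_nonneg_left hSA hD₂₀.le
      have h₃ : D₂ * (1 / (2 * D₂)) = 1 / 2 := by field_simp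
      rw [← mul_assoc, ← hD₂] at h₁
      linear_combination 2 * h₁ + 2 * h₂ + 2 * T * h₃
    have hmax : 0 ≤ max V B := by
      by_contra! hneg
      have : K₃ * V + K * B < 0 := by
        have := mul_neg_of_pos_of_neg hK₃₀ ((le_max_left V B).trans_lt hneg)
        have := mul_neg_of_pos_of_neg hK₀ ((le_max_right V B).trans_lt hneg)
        linarith
      have := mul_neg_of_pos_of_neg (by positivity : 0 < 2 * D₂) this
      linarith
    calc T ≤ 2 * D₂ * (K₃ * max V B + K * max V B) := by
          refine hTD.trans ?_
          gcongr
          · exact le_max_left V B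
          · exact le_max_right V B
      _ = 2 * D₂ * (K₃ + K) * max V B := by ring
      _ ≤ _ := by
          gcongr
          exact le_add_of_nonneg_left (by positivity)

/-- **Itô isomorphism in Hilbert spaces, case `2 ≤ p < ∞`** (discrete model of the
Poisson stochastic integral): for a Hilbert space `H` and `2 ≤ p < ∞` there are
constants `c, C > 0` depending only on `p` such that
`c max{ (E(∑ λ_i ‖y_i‖²)^{p/2})^{1/p}, (∑ λ_i E‖y_i‖^p)^{1/p} }
  ≤ (E max_{1≤m≤n} ‖∑_{i=1}^m Ñ_i y_i‖^p)^{1/p}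
  ≤ C max{ (E(∑ λ_i ‖y_i‖²)^{p/2})^{1/p}, (∑ λ_i E‖y_i‖^p)^{1/p} }`. -/
theorem poisson_ito_isomorphism_hilbert_two_le_p (p : ℝ) (hp : 2 ≤ p) :
    ∃ c C : ℝ, 0 < c ∧ 0 < C ∧
    ∀ (H : Type) (_ : NormedAddCommGroup H), ∀ (_ : InnerProductSpace ℝ H)
      (_ : CompleteSpace H),
    ∀ (Ω : Type) (mΩ : MeasurableSpace Ω) (μ : Measure Ω), IsProbabilityMeasure μ →
    ∀ (𝒢 : Filtration ℕ mΩ) (n : ℕ) (hn : 1 ≤ n)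
      (N : ℕ → Ω → ℕ) (lam : ℕ → ℝ≥0) (y : ℕ → Ω → H),
      (∀ i ∈ Finset.Icc 1 n, lam i ≤ 1) →
      (∀ i ∈ Finset.Icc 1 n, Measurable[𝒢 i] (N i)) →
      (∀ i ∈ Finset.Icc 1 n, Measure.map (N i) μ = poissonMeasure (lam i)) →
      (∀ i ∈ Finset.Icc 1 n,
        Indep (MeasurableSpace.comap (N i) inferInstance) (𝒢 (i - 1)) μ) →
      (∀ i ∈ Finset.Icc 1 n, StronglyMeasurable[𝒢 (i - 1)] (y i)) →
      (∀ i ∈ Finset.Icc 1 n, ∃ c' : ℝ, ∀ ω, ‖y i ω‖ ≤ c') →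
      c * max ((∫ ω, (∑ i ∈ Finset.Icc 1 n, (lam i : ℝ) * ‖y i ω‖ ^ (2 : ℝ)) ^ (p / 2) ∂μ) ^ (1 / p))
              ((∑ i ∈ Finset.Icc 1 n, (lam i : ℝ) * ∫ ω, ‖y i ω‖ ^ p ∂μ) ^ (1 / p))
        ≤ (∫ ω, ((Finset.Icc 1 n).sup' (Finset.nonempty_Icc.mpr hn) fun m =>
              ‖∑ i ∈ Finset.Icc 1 m, ((N i ω : ℝ) - lam i) • y i ω‖) ^ p ∂μ) ^ (1 / p) ∧
      (∫ ω, ((Finset.Icc 1 n).sup' (Finset.nonempty_Icc.mpr hn) fun m =>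
            ‖∑ i ∈ Finset.Icc 1 m, ((N i ω : ℝ) - lam i) • y i ω‖) ^ p ∂μ) ^ (1 / p)
        ≤ C * max ((∫ ω, (∑ i ∈ Finset.Icc 1 n, (lam i : ℝ) * ‖y i ω‖ ^ (2 : ℝ)) ^ (p / 2) ∂μ) ^ (1 / p))
              ((∑ i ∈ Finset.Icc 1 n, (lam i : ℝ) * ∫ ω, ‖y i ω‖ ^ p ∂μ) ^ (1 / p)) := by
  obtain ⟨D, hD, key⟩ := exists_integral_poissonMax_rpow_equiv hp
  have hp₀ : 0 ≤ 1 / p := one_div_nonneg.2 (by linarith)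
  refine ⟨(D ^ (1 / p))⁻¹, D ^ (1 / p), by positivity, by positivity, ?_⟩
  intro H _ _ _ Ω mΩ μ _ 𝒢 n hn N lam y hlam hmeas hmap hindep hy hbdd
  have hmem {k : ℕ} (hk : k < n) : k + 1 ∈ Finset.Icc 1 n := Finset.mem_Icc.2 ⟨by omega, hk⟩
  have h : DiscretePoissonModel μ 𝒢 n N lam y :=
    ⟨fun k hk => hlam _ (hmem hk), fun k hk => hmeas _ (hmem hk), fun k hk => hmap _ (hmem hk),
      fun k hk => hindep _ (hmem hk), fun k hk => hy _ (hmem hk), fun k hk => hbdd _ (hmem hk)⟩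
  obtain ⟨hlow, hup⟩ := key h
  have hS (ω : Ω) : ((Finset.Icc 1 n).sup' (Finset.nonempty_Icc.mpr hn) fun m =>
      ‖∑ i ∈ Finset.Icc 1 m, ((N i ω : ℝ) - lam i) • y i ω‖) = poissonMax N lam y n ω :=
    sup'_norm_poissonSum _ ω
  have hA (ω : Ω) : ∑ i ∈ Finset.Icc 1 n, (lam i : ℝ) * ‖y i ω‖ ^ (2 : ℝ)
      = poissonVar lam y n ω := by
    simp only [Real.rpow_two, poissonVar]
  have hV₀ : 0 ≤ ∫ ω, poissonVar lam y n ω ^ (p / 2) ∂μ :=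
    integral_nonneg fun ω => Real.rpow_nonneg (poissonVar_nonneg n ω) _
  have hB₀ : 0 ≤ ∑ i ∈ Finset.Icc 1 n, (lam i : ℝ) * ∫ ω, ‖y i ω‖ ^ p ∂μ :=
    Finset.sum_nonneg fun i _ => mul_nonneg (lam i).coe_nonneg
      (integral_nonneg fun ω => by positivity)
  have hT₀ : 0 ≤ ∫ ω, poissonMax N lam y n ω ^ p ∂μ :=
    integral_nonneg fun ω => Real.rpow_nonneg (poissonMax_nonneg n ω) _
  simp only [hS, hA]
  rw [← (Real.monotoneOn_rpow_Ici_of_exponent_nonneg hp₀).map_max hV₀ hB₀]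
  have hmax := hV₀.trans (le_max_left _ (∑ i ∈ Finset.Icc 1 n, (lam i : ℝ) * ∫ ω, ‖y i ω‖ ^ p ∂μ))
  constructor
  · rw [inv_mul_le_iff₀ (by positivity), ← Real.mul_rpow hD.le hT₀]
    exact Real.rpow_le_rpow hmax hlow hp₀
  · rw [← Real.mul_rpow hD.le hmax]
    exact Real.rpow_le_rpow hT₀ hup hp₀
end
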